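/- For every z in the upper half-plane ℍ, Φ₃₀(x(z)) = Δ(z)²·E₆(z), where x(z) = (x₁(z),...,x₆(z)) is the vector of eta-multiplied theta constants of order 13, Δ(z) = η(z)²⁴ is the modular discriminant and E₆ is the normalized Eisenstein series of weight 6. -/

import Mathlib

noncomputable section

open Complex

def ζ : ℂ := Complex.exp (2 * Real.pi * Complex.I / 13)

def AA0 (v : Fin 6 → ℂ) : ℂ := v 0 * v 3 + v 1 * v 4 + v 2 * v 5
def AA1 (v : Fin 6 → ℂ) : ℂ := (v 0) ^ 2 - 2 * v 2 * v 3
def AA2 (v : Fin 6 → ℂ) : ℂ := -(v 4) ^ 2 - 2 * v 1 * v 3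
def AA3 (v : Fin 6 → ℂ) : ℂ := (v 1) ^ 2 - 2 * v 0 * v 4
def AA4 (v : Fin 6 → ℂ) : ℂ := (v 2) ^ 2 - 2 * v 1 * v 5
def AA5 (v : Fin 6 → ℂ) : ℂ := -(v 3) ^ 2 - 2 * v 0 * v 5
def AA6 (v : Fin 6 → ℂ) : ℂ := -(v 5) ^ 2 - 2 * v 2 * v 4

def DD0 (v : Fin 6 → ℂ) : ℂ := v 0 * v 1 * v 2
def DD1 (v : Fin 6 → ℂ) : ℂ := 2 * v 1 * (v 2) ^ 2 + (v 1) ^ 2 * v 5 - (v 3) ^ 2 * v 4 + v 0 * v 4 * v 5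
def DD2 (v : Fin 6 → ℂ) : ℂ := -(v 5) ^ 3 + (v 1) ^ 2 * v 3 - 2 * v 1 * (v 4) ^ 2 + v 0 * v 3 * v 4 + 3 * v 2 * v 4 * v 5
def DD3 (v : Fin 6 → ℂ) : ℂ := 2 * v 0 * (v 1) ^ 2 + (v 0) ^ 2 * v 4 - v 3 * (v 5) ^ 2 + v 2 * v 3 * v 4
def DD4 (v : Fin 6 → ℂ) : ℂ := -(v 1) ^ 2 * v 2 + v 0 * (v 5) ^ 2 - 2 * (v 3) ^ 2 * v 5 - v 0 * v 2 * v 4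
def DD5 (v : Fin 6 → ℂ) : ℂ := -(v 3) ^ 3 + (v 2) ^ 2 * v 4 - 2 * v 2 * (v 5) ^ 2 + v 1 * v 4 * v 5 + 3 * v 0 * v 3 * v 5
def DD6 (v : Fin 6 → ℂ) : ℂ := -(v 4) ^ 3 + (v 0) ^ 2 * v 5 - 2 * v 0 * (v 3) ^ 2 + v 2 * v 3 * v 5 + 3 * v 1 * v 3 * v 4
def DD7 (v : Fin 6 → ℂ) : ℂ := -(v 1) ^ 3 + v 2 * (v 3) ^ 2 - v 0 * v 2 * v 5 - 3 * v 0 * v 1 * v 4 + 2 * (v 0) ^ 2 * v 3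
def DD8 (v : Fin 6 → ℂ) : ℂ := -(v 0) ^ 3 + v 1 * (v 5) ^ 2 - v 1 * v 2 * v 4 - 3 * v 0 * v 2 * v 3 + 2 * (v 2) ^ 2 * v 5
def DD9 (v : Fin 6 → ℂ) : ℂ := 2 * (v 0) ^ 2 * v 2 + (v 2) ^ 2 * v 3 - (v 4) ^ 2 * v 5 + v 1 * v 3 * v 5
def DD10 (v : Fin 6 → ℂ) : ℂ := -(v 0) * (v 2) ^ 2 + v 1 * (v 3) ^ 2 - 2 * v 3 * (v 4) ^ 2 - v 0 * v 1 * v 5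
def DD11 (v : Fin 6 → ℂ) : ℂ := -(v 2) ^ 3 + v 0 * (v 4) ^ 2 - v 0 * v 1 * v 3 - 3 * v 1 * v 2 * v 5 + 2 * (v 1) ^ 2 * v 4
def DD12 (v : Fin 6 → ℂ) : ℂ := -(v 0) ^ 2 * v 1 + v 2 * (v 4) ^ 2 - 2 * v 4 * (v 5) ^ 2 - v 1 * v 2 * v 3
def DDinf (v : Fin 6 → ℂ) : ℂ := v 3 * v 4 * v 5

def GG0 (v : Fin 6 → ℂ) : ℂ := (DD0 v) ^ 2 + (DDinf v) ^ 2
def GG1 (v : Fin 6 → ℂ) : ℂ := -(DD7 v) ^ 2 + 2 * DD0 v * DD1 v + 10 * DDinf v * DD1 v + 2 * DD2 v * DD12 v - 2 * DD3 v * DD11 v - 4 * DD4 v * DD10 v - 2 * DD9 v * DD5 v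
def GG2 (v : Fin 6 → ℂ) : ℂ := -2 * (DD1 v) ^ 2 - 4 * DD0 v * DD2 v + 6 * DDinf v * DD2 v - 2 * DD4 v * DD11 v + 2 * DD5 v * DD10 v - 2 * DD6 v * DD9 v - 2 * DD7 v * DD8 v
def GG3 (v : Fin 6 → ℂ) : ℂ := -(DD8 v) ^ 2 + 2 * DD0 v * DD3 v + 10 * DDinf v * DD3 v + 2 * DD6 v * DD10 v - 2 * DD9 v * DD7 v - 4 * DD12 v * DD4 v - 2 * DD1 v * DD2 v
def GG4 (v : Fin 6 → ℂ) : ℂ := -(DD2 v) ^ 2 + 10 * DD0 v * DD4 v - 2 * DDinf v * DD4 v + 2 * DD5 v * DD12 v - 2 * DD9 v * DD8 v - 4 * DD1 v * DD3 v - 2 * DD10 v * DD7 v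
def GG5 (v : Fin 6 → ℂ) : ℂ := -2 * (DD9 v) ^ 2 - 4 * DD0 v * DD5 v + 6 * DDinf v * DD5 v - 2 * DD10 v * DD8 v + 2 * DD6 v * DD12 v - 2 * DD2 v * DD3 v - 2 * DD11 v * DD7 v
def GG6 (v : Fin 6 → ℂ) : ℂ := -2 * (DD3 v) ^ 2 - 4 * DD0 v * DD6 v + 6 * DDinf v * DD6 v - 2 * DD12 v * DD7 v + 2 * DD2 v * DD4 v - 2 * DD5 v * DD1 v - 2 * DD8 v * DD11 v
def GG7 (v : Fin 6 → ℂ) : ℂ := -2 * (DD10 v) ^ 2 + 6 * DD0 v * DD7 v + 4 * DDinf v * DD7 v - 2 * DD1 v * DD6 v - 2 * DD2 v * DD5 v - 2 * DD8 v * DD12 v - 2 * DD9 v * DD11 v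
def GG8 (v : Fin 6 → ℂ) : ℂ := -2 * (DD4 v) ^ 2 + 6 * DD0 v * DD8 v + 4 * DDinf v * DD8 v - 2 * DD3 v * DD5 v - 2 * DD6 v * DD2 v - 2 * DD11 v * DD10 v - 2 * DD1 v * DD7 v
def GG9 (v : Fin 6 → ℂ) : ℂ := -(DD11 v) ^ 2 + 2 * DD0 v * DD9 v + 10 * DDinf v * DD9 v + 2 * DD5 v * DD4 v - 2 * DD1 v * DD8 v - 4 * DD10 v * DD12 v - 2 * DD3 v * DD6 v
def GG10 (v : Fin 6 → ℂ) : ℂ := -(DD5 v) ^ 2 + 10 * DD0 v * DD10 v - 2 * DDinf v * DD10 v + 2 * DD6 v * DD4 v - 2 * DD3 v * DD7 v - 4 * DD9 v * DD1 v - 2 * DD12 v * DD11 v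
def GG11 (v : Fin 6 → ℂ) : ℂ := -2 * (DD12 v) ^ 2 + 6 * DD0 v * DD11 v + 4 * DDinf v * DD11 v - 2 * DD9 v * DD2 v - 2 * DD5 v * DD6 v - 2 * DD7 v * DD4 v - 2 * DD3 v * DD8 v
def GG12 (v : Fin 6 → ℂ) : ℂ := -(DD6 v) ^ 2 + 10 * DD0 v * DD12 v - 2 * DDinf v * DD12 v + 2 * DD2 v * DD10 v - 2 * DD1 v * DD11 v - 4 * DD3 v * DD9 v - 2 * DD4 v * DD8 v

def wInf (v : Fin 6 → ℂ) : ℂ := 13 * (AA0 v) ^ 2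
def wF (ν : ℕ) (v : Fin 6 → ℂ) : ℂ :=
  (AA0 v + ζ ^ ν * AA1 v + ζ ^ (4 * ν) * AA2 v + ζ ^ (9 * ν) * AA3 v + ζ ^ (3 * ν) * AA4 v
    + ζ ^ (12 * ν) * AA5 v + ζ ^ (10 * ν) * AA6 v) ^ 2
def dInf (v : Fin 6 → ℂ) : ℂ := 13 ^ 2 * GG0 v
def dF (ν : ℕ) (v : Fin 6 → ℂ) : ℂ :=
  -13 * GG0 v + ζ ^ ν * GG1 v + ζ ^ (2 * ν) * GG2 v + ζ ^ (3 * ν) * GG3 v + ζ ^ (4 * ν) * GG4 v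
    + ζ ^ (5 * ν) * GG5 v + ζ ^ (6 * ν) * GG6 v + ζ ^ (7 * ν) * GG7 v + ζ ^ (8 * ν) * GG8 v
    + ζ ^ (9 * ν) * GG9 v + ζ ^ (10 * ν) * GG10 v + ζ ^ (11 * ν) * GG11 v + ζ ^ (12 * ν) * GG12 v

def Phi12 (v : Fin 6 → ℂ) : ℂ :=
  -(1 / (13 * 52) : ℂ) * ((∑ ν ∈ Finset.range 13, (dF ν v) ^ 2) + (dInf v) ^ 2)
def Phi18 (v : Fin 6 → ℂ) : ℂ :=
  (1 / (13 * 6) : ℂ) * ((∑ ν ∈ Finset.range 13, (dF ν v) ^ 3) + (dInf v) ^ 3)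
def Phi30 (v : Fin 6 → ℂ) : ℂ :=
  -(1 / (13 * 1315) : ℂ) * ((∑ ν ∈ Finset.range 13, (dF ν v) ^ 5) + (dInf v) ^ 5)
def Phi42 (v : Fin 6 → ℂ) : ℂ :=
  (1 / (13 * 226842) : ℂ) * ((∑ ν ∈ Finset.range 13, (dF ν v) ^ 7) + (dInf v) ^ 7)

def Phi20 (v : Fin 6 → ℂ) : ℂ :=
  (1 / (13 * 25) : ℂ) * ((∑ ν ∈ Finset.range 13, (wF ν v) ^ 5) + (wInf v) ^ 5)
def Phi32 (v : Fin 6 → ℂ) : ℂ :=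
  -(1 / (13 * 1840) : ℂ) * ((∑ ν ∈ Finset.range 13, (wF ν v) ^ 8) + (wInf v) ^ 8)
def Phi44 (v : Fin 6 → ℂ) : ℂ :=
  (1 / (13 * 146905) : ℂ) * ((∑ ν ∈ Finset.range 13, (wF ν v) ^ 11) + (wInf v) ^ 11)

def th13 (c : ℚ) (k : ℤ) (z : ℂ) : ℂ :=
  Complex.exp (2 * Real.pi * Complex.I * (c : ℂ) * z) *
    ∑' n : ℤ, (-1 : ℂ) ^ n *
      Complex.exp (2 * Real.pi * Complex.I * (((13 * n ^ 2 + k * n : ℤ) : ℂ) / 2) * z)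

def ta : Fin 6 → ℂ → ℂ :=
  ![th13 (121 / 104) 11, th13 (49 / 104) 7, th13 (25 / 104) 5,
    fun z => -th13 (9 / 104) 3 z, th13 (81 / 104) 9, th13 (1 / 104) 1]

def AV (z : ℂ) : Fin 6 → ℂ := fun i => ta i z

def etaF (z : ℂ) : ℂ :=
  Complex.exp (2 * Real.pi * Complex.I * z / 24) *
    ∏' n : ℕ, (1 - Complex.exp (2 * Real.pi * Complex.I * z) ^ (n + 1))

def xV (z : ℂ) : Fin 6 → ℂ := fun i => etaF z * ta i z

def Δfun (z : ℂ) : ℂ := (etaF z) ^ 24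

def Eis (k : ℕ) (z : ℂ) : ℂ :=
  (1 / 2 : ℂ) * ∑' p : {p : ℤ × ℤ // Int.gcd p.1 p.2 = 1},
    1 / ((p.val.1 : ℂ) * z + (p.val.2 : ℂ)) ^ k

set_option maxHeartbeats 4000000 in
set_option maxRecDepth 100000 in
/-- The product of three sine transforms, expanded in the cubic forms. -/
lemma sine_product_expansion {ζ : ℂ} (h : ζ ^ 13 = 1) (v : Fin 6 → ℂ) :
    ((ζ ^ 12 - ζ) * v 0 + (ζ ^ 10 - ζ ^ 3) * v 1 + (ζ ^ 4 - ζ ^ 9) * v 2 + (ζ ^ 5 - ζ ^ 8) * v 3 +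
    (ζ ^ 2 - ζ ^ 11) * v 4 + (ζ ^ 6 - ζ ^ 7) * v 5) * ((ζ ^ 10 - ζ ^ 3) * v 0 + (ζ ^ 4 - ζ ^ 9) *
    v 1 + (ζ ^ 12 - ζ) * v 2 + (ζ ^ 2 - ζ ^ 11) * v 3 + (ζ ^ 6 - ζ ^ 7) * v 4 + (ζ ^ 5 - ζ ^ 8) *
    v 5) * ((ζ ^ 4 - ζ ^ 9) * v 0 + (ζ ^ 12 - ζ) * v 1 + (ζ ^ 10 - ζ ^ 3) * v 2 + (ζ ^ 6 - ζ ^ 7)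
    * v 3 + (ζ ^ 5 - ζ ^ 8) * v 4 + (ζ ^ 2 - ζ ^ 11) * v 5) =
      -((-2 * (ζ - ζ ^ 12 + ζ ^ 3 - ζ ^ 10 + ζ ^ 9 - ζ ^ 4) + 3 * (ζ ^ 2 - ζ ^ 11 + ζ ^ 5 - ζ ^ 8
      + ζ ^ 6 - ζ ^ 7)) * DD0 v + (3 * (ζ - ζ ^ 12 + ζ ^ 3 - ζ ^ 10 + ζ ^ 9 - ζ ^ 4) + 2 * (ζ ^ 2
      - ζ ^ 11 + ζ ^ 5 - ζ ^ 8 + ζ ^ 6 - ζ ^ 7)) * DDinf v - ((ζ - ζ ^ 12 + ζ ^ 3 - ζ ^ 10 + ζ ^ 9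
      - ζ ^ 4) + (ζ ^ 2 - ζ ^ 11 + ζ ^ 5 - ζ ^ 8 + ζ ^ 6 - ζ ^ 7)) * (DD1 v + DD3 v + DD9 v) - (ζ
      - ζ ^ 12 + ζ ^ 3 - ζ ^ 10 + ζ ^ 9 - ζ ^ 4) * (DD2 v + DD5 v + DD6 v) - (ζ ^ 2 - ζ ^ 11 + ζ ^
      5 - ζ ^ 8 + ζ ^ 6 - ζ ^ 7) * (DD7 v + DD8 v + DD11 v) + ((ζ - ζ ^ 12 + ζ ^ 3 - ζ ^ 10 + ζ ^
      9 - ζ ^ 4) - (ζ ^ 2 - ζ ^ 11 + ζ ^ 5 - ζ ^ 8 + ζ ^ 6 - ζ ^ 7)) *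
      (DD4 v + DD10 v + DD12 v)) := by
  unfold DD0 DD1 DD2 DD3 DD4 DD5 DD6 DD7 DD8 DD9 DD10 DD11 DD12 DDinf
  linear_combination (
    v 5 ^ 3 * (-ζ ^ 1 - ζ ^ 3 + ζ ^ 4 - ζ ^ 9 + ζ ^ 10 + ζ ^ 12 - ζ ^ 13) + v 4 * v 5 ^ 2 * (2 * ζ
    ^ 1 - 2 * ζ ^ 2 + 2 * ζ ^ 3 - 2 * ζ ^ 4 - 2 * ζ ^ 5 - 2 * ζ ^ 6 + 2 * ζ ^ 7 + 2 * ζ ^ 8 + ζ ^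
    9 - 2 * ζ ^ 10 + 2 * ζ ^ 11 - ζ ^ 12 + ζ ^ 14 - ζ ^ 17) + v 4 ^ 2 * v 5 * (-ζ ^ 1 - ζ ^ 2 - ζ
    ^ 3 + ζ ^ 4 - ζ ^ 5 - ζ ^ 6 + ζ ^ 7 + ζ ^ 8 - ζ ^ 9 + 2 * ζ ^ 11 - ζ ^ 14 + ζ ^ 15 - ζ ^ 16) +
    v 4 ^ 3 * (-ζ ^ 1 - ζ ^ 3 + ζ ^ 4 - ζ ^ 9 + ζ ^ 10 + ζ ^ 12 - ζ ^ 13) + v 3 * v 5 ^ 2 * (-ζ ^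
    1 - ζ ^ 2 - ζ ^ 3 + ζ ^ 4 - ζ ^ 5 - ζ ^ 6 + ζ ^ 7 + ζ ^ 8 - ζ ^ 9 + 2 * ζ ^ 11 - ζ ^ 14 + ζ ^
    15 - ζ ^ 16) + v 3 * v 4 * v 5 * (-3 * ζ ^ 1 - 2 * ζ ^ 2 - 3 * ζ ^ 3 + 3 * ζ ^ 4 - 2 * ζ ^ 5 -
    3 * ζ ^ 6 + 2 * ζ ^ 7 + 2 * ζ ^ 8 - 3 * ζ ^ 9 + 3 * ζ ^ 10 + 2 * ζ ^ 11 + 3 * ζ ^ 12 - 3 * ζ ^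
    13 - ζ ^ 20) + v 3 * v 4 ^ 2 * (2 * ζ ^ 1 - 2 * ζ ^ 2 + 2 * ζ ^ 3 - 2 * ζ ^ 4 - 2 * ζ ^ 5 - 2
    * ζ ^ 6 + 2 * ζ ^ 7 + 2 * ζ ^ 8 + ζ ^ 9 - 2 * ζ ^ 10 + 2 * ζ ^ 11 - ζ ^ 12 + ζ ^ 14 - ζ ^ 17)
    + v 3 ^ 2 * v 5 * (2 * ζ ^ 1 - 2 * ζ ^ 2 + 2 * ζ ^ 3 - 2 * ζ ^ 4 - 2 * ζ ^ 5 - 2 * ζ ^ 6 + 2 *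
    ζ ^ 7 + 2 * ζ ^ 8 + ζ ^ 9 - 2 * ζ ^ 10 + 2 * ζ ^ 11 - ζ ^ 12 + ζ ^ 14 - ζ ^ 17) + v 3 ^ 2 * v
    4 * (-ζ ^ 1 - ζ ^ 2 - ζ ^ 3 + ζ ^ 4 - ζ ^ 5 - ζ ^ 6 + ζ ^ 7 + ζ ^ 8 - ζ ^ 9 + 2 * ζ ^ 11 - ζ ^
    14 + ζ ^ 15 - ζ ^ 16) + v 3 ^ 3 * (-ζ ^ 1 - ζ ^ 3 + ζ ^ 4 - ζ ^ 9 + ζ ^ 10 + ζ ^ 12 - ζ ^ 13)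
    + v 2 * v 5 ^ 2 * (-2 * ζ ^ 1 - 2 * ζ ^ 3 + 2 * ζ ^ 4 - ζ ^ 9 + ζ ^ 10 - ζ ^ 11 + 2 * ζ ^ 12 -
    ζ ^ 15 - ζ ^ 16 + ζ ^ 17) + v 2 * v 4 * v 5 * (3 * ζ ^ 1 + 3 * ζ ^ 3 - 3 * ζ ^ 4 + ζ ^ 5 + 3 *
    ζ ^ 9 - 2 * ζ ^ 10 - 3 * ζ ^ 12 - ζ ^ 13 + ζ ^ 16 + ζ ^ 21) + v 2 * v 4 ^ 2 * (-ζ ^ 1 + ζ ^ 2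
    - ζ ^ 3 + ζ ^ 4 + ζ ^ 5 + ζ ^ 6 - ζ ^ 7 - ζ ^ 9 + ζ ^ 10 - ζ ^ 11 - ζ ^ 14 + ζ ^ 18) + v 2 * v
    3 * v 5 * (ζ ^ 1 + ζ ^ 3 - ζ ^ 4 + ζ ^ 9 - ζ ^ 10 - 2 * ζ ^ 12 + 3 * ζ ^ 13 - ζ ^ 14) + v 2 *
    v 3 * v 4 * (ζ ^ 1 + ζ ^ 2 + ζ ^ 3 - ζ ^ 4 + ζ ^ 5 + ζ ^ 6 - ζ ^ 8 + 2 * ζ ^ 9 - 2 * ζ ^ 10 -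
    ζ ^ 11 - ζ ^ 12 - ζ ^ 16 + ζ ^ 17 + ζ ^ 19) + v 2 * v 3 ^ 2 * (ζ ^ 2 + ζ ^ 5 + ζ ^ 6 - ζ ^ 7 -
    ζ ^ 8 + ζ ^ 10 - ζ ^ 11 - ζ ^ 13 + ζ ^ 16) + v 2 ^ 2 * v 5 * (2 * ζ ^ 2 + 2 * ζ ^ 5 + 2 * ζ ^
    6 - ζ ^ 7 - 2 * ζ ^ 8 - ζ ^ 10 - ζ ^ 11 + ζ ^ 15 - ζ ^ 16 + ζ ^ 19) + v 2 ^ 2 * v 4 * (ζ ^ 1 +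
    ζ ^ 3 - ζ ^ 4 - ζ ^ 6 + ζ ^ 9 - ζ ^ 12 + ζ ^ 13 + ζ ^ 16 - ζ ^ 20) + v 2 ^ 2 * v 3 * (ζ ^ 1 +
    ζ ^ 2 + ζ ^ 3 - ζ ^ 4 + ζ ^ 5 + ζ ^ 6 - ζ ^ 7 - ζ ^ 8 + ζ ^ 9 - ζ ^ 10 - ζ ^ 12 + ζ ^ 15) + v
    2 ^ 3 * (-ζ ^ 2 - ζ ^ 5 - ζ ^ 6 + ζ ^ 7 + ζ ^ 11 + ζ ^ 13 - ζ ^ 18) + v 1 * v 5 ^ 2 * (ζ ^ 2 +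
    ζ ^ 5 + ζ ^ 6 - ζ ^ 7 - ζ ^ 8 + ζ ^ 10 - ζ ^ 11 - ζ ^ 13 + ζ ^ 16) + v 1 * v 4 * v 5 * (ζ ^ 1
    + ζ ^ 3 - ζ ^ 4 + ζ ^ 9 - ζ ^ 10 - 2 * ζ ^ 12 + 3 * ζ ^ 13 - ζ ^ 14) + v 1 * v 4 ^ 2 * (-2 * ζ
    ^ 1 - 2 * ζ ^ 3 + 2 * ζ ^ 4 - ζ ^ 9 + ζ ^ 10 - ζ ^ 11 + 2 * ζ ^ 12 - ζ ^ 15 - ζ ^ 16 + ζ ^ 17)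
    + v 1 * v 3 * v 5 * (ζ ^ 1 + ζ ^ 2 + ζ ^ 3 - ζ ^ 4 + ζ ^ 5 + ζ ^ 6 - ζ ^ 8 + 2 * ζ ^ 9 - 2 * ζ
    ^ 10 - ζ ^ 11 - ζ ^ 12 - ζ ^ 16 + ζ ^ 17 + ζ ^ 19) + v 1 * v 3 * v 4 * (3 * ζ ^ 1 + 3 * ζ ^ 3
    - 3 * ζ ^ 4 + ζ ^ 5 + 3 * ζ ^ 9 - 2 * ζ ^ 10 - 3 * ζ ^ 12 - ζ ^ 13 + ζ ^ 16 + ζ ^ 21) + v 1 *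
    v 3 ^ 2 * (-ζ ^ 1 + ζ ^ 2 - ζ ^ 3 + ζ ^ 4 + ζ ^ 5 + ζ ^ 6 - ζ ^ 7 - ζ ^ 9 + ζ ^ 10 - ζ ^ 11 -
    ζ ^ 14 + ζ ^ 18) + v 1 * v 2 * v 5 * (-3 * ζ ^ 2 - 3 * ζ ^ 5 - 4 * ζ ^ 6 + 3 * ζ ^ 7 + 2 * ζ ^
    8 + ζ ^ 9 + 2 * ζ ^ 11 + ζ ^ 13 - ζ ^ 15 + ζ ^ 17 - ζ ^ 18 - ζ ^ 20) + v 1 * v 2 * v 4 * (-ζ ^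
    2 - ζ ^ 4 - ζ ^ 5 - ζ ^ 6 + ζ ^ 7 + ζ ^ 8 + 2 * ζ ^ 11 - ζ ^ 12 + ζ ^ 13 - ζ ^ 14 + ζ ^ 15 - ζ
    ^ 22) + v 1 * v 2 * v 3 * (ζ ^ 1 - ζ ^ 2 + ζ ^ 3 - ζ ^ 4 - ζ ^ 5 - ζ ^ 6 + ζ ^ 7 + ζ ^ 9 - ζ ^
    10 + 2 * ζ ^ 11 - ζ ^ 12 + ζ ^ 15 - ζ ^ 18) + v 1 * v 2 ^ 2 * (2 * ζ ^ 1 + 2 * ζ ^ 2 + 2 * ζ ^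
    3 - 2 * ζ ^ 4 + 2 * ζ ^ 5 + ζ ^ 6 - ζ ^ 7 - 2 * ζ ^ 8 + 2 * ζ ^ 9 - 2 * ζ ^ 10 - 2 * ζ ^ 12 +
    2 * ζ ^ 15 + ζ ^ 19 - ζ ^ 20) + v 1 ^ 2 * v 5 * (ζ ^ 1 + ζ ^ 2 + ζ ^ 3 - ζ ^ 4 + ζ ^ 5 + ζ ^ 6
    - ζ ^ 7 - ζ ^ 8 + ζ ^ 9 - ζ ^ 10 - ζ ^ 12 + ζ ^ 15) + v 1 ^ 2 * v 4 * (2 * ζ ^ 2 + 2 * ζ ^ 5 +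
    2 * ζ ^ 6 - ζ ^ 7 - 2 * ζ ^ 8 - ζ ^ 10 - ζ ^ 11 + ζ ^ 15 - ζ ^ 16 + ζ ^ 19) + v 1 ^ 2 * v 3 *
    (ζ ^ 1 + ζ ^ 3 - ζ ^ 4 - ζ ^ 6 + ζ ^ 9 - ζ ^ 12 + ζ ^ 13 + ζ ^ 16 - ζ ^ 20) + v 1 ^ 2 * v 2 *
    (ζ ^ 1 - ζ ^ 2 + ζ ^ 3 - ζ ^ 4 - ζ ^ 6 + ζ ^ 7 + ζ ^ 8 + 2 * ζ ^ 9 - 2 * ζ ^ 10 + ζ ^ 11 - 2 *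
    ζ ^ 12 - ζ ^ 14 - ζ ^ 16 + ζ ^ 17 + ζ ^ 21) + v 1 ^ 3 * (-ζ ^ 2 - ζ ^ 5 - ζ ^ 6 + ζ ^ 7 + ζ ^
    11 + ζ ^ 13 - ζ ^ 18) + v 0 * v 5 ^ 2 * (-ζ ^ 1 + ζ ^ 2 - ζ ^ 3 + ζ ^ 4 + ζ ^ 5 + ζ ^ 6 - ζ ^
    7 - ζ ^ 9 + ζ ^ 10 - ζ ^ 11 - ζ ^ 14 + ζ ^ 18) + v 0 * v 4 * v 5 * (ζ ^ 1 + ζ ^ 2 + ζ ^ 3 - ζ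
    ^ 4 + ζ ^ 5 + ζ ^ 6 - ζ ^ 8 + 2 * ζ ^ 9 - 2 * ζ ^ 10 - ζ ^ 11 - ζ ^ 12 - ζ ^ 16 + ζ ^ 17 + ζ ^
    19) + v 0 * v 4 ^ 2 * (ζ ^ 2 + ζ ^ 5 + ζ ^ 6 - ζ ^ 7 - ζ ^ 8 + ζ ^ 10 - ζ ^ 11 - ζ ^ 13 + ζ ^
    16) + v 0 * v 3 * v 5 * (3 * ζ ^ 1 + 3 * ζ ^ 3 - 3 * ζ ^ 4 + ζ ^ 5 + 3 * ζ ^ 9 - 2 * ζ ^ 10 -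
    3 * ζ ^ 12 - ζ ^ 13 + ζ ^ 16 + ζ ^ 21) + v 0 * v 3 * v 4 * (ζ ^ 1 + ζ ^ 3 - ζ ^ 4 + ζ ^ 9 - ζ
    ^ 10 - 2 * ζ ^ 12 + 3 * ζ ^ 13 - ζ ^ 14) + v 0 * v 3 ^ 2 * (-2 * ζ ^ 1 - 2 * ζ ^ 3 + 2 * ζ ^ 4
    - ζ ^ 9 + ζ ^ 10 - ζ ^ 11 + 2 * ζ ^ 12 - ζ ^ 15 - ζ ^ 16 + ζ ^ 17) + v 0 * v 2 * v 5 * (-ζ ^ 2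
    - ζ ^ 4 - ζ ^ 5 - ζ ^ 6 + ζ ^ 7 + ζ ^ 8 + 2 * ζ ^ 11 - ζ ^ 12 + ζ ^ 13 - ζ ^ 14 + ζ ^ 15 - ζ ^
    22) + v 0 * v 2 * v 4 * (ζ ^ 1 - ζ ^ 2 + ζ ^ 3 - ζ ^ 4 - ζ ^ 5 - ζ ^ 6 + ζ ^ 7 + ζ ^ 9 - ζ ^
    10 + 2 * ζ ^ 11 - ζ ^ 12 + ζ ^ 15 - ζ ^ 18) + v 0 * v 2 * v 3 * (-3 * ζ ^ 2 - 3 * ζ ^ 5 - 4 *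
    ζ ^ 6 + 3 * ζ ^ 7 + 2 * ζ ^ 8 + ζ ^ 9 + 2 * ζ ^ 11 + ζ ^ 13 - ζ ^ 15 + ζ ^ 17 - ζ ^ 18 - ζ ^
    20) + v 0 * v 2 ^ 2 * (ζ ^ 1 - ζ ^ 2 + ζ ^ 3 - ζ ^ 4 - ζ ^ 6 + ζ ^ 7 + ζ ^ 8 + 2 * ζ ^ 9 - 2 *
    ζ ^ 10 + ζ ^ 11 - 2 * ζ ^ 12 - ζ ^ 14 - ζ ^ 16 + ζ ^ 17 + ζ ^ 21) + v 0 * v 1 * v 5 * (ζ ^ 1 -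
    ζ ^ 2 + ζ ^ 3 - ζ ^ 4 - ζ ^ 5 - ζ ^ 6 + ζ ^ 7 + ζ ^ 9 - ζ ^ 10 + 2 * ζ ^ 11 - ζ ^ 12 + ζ ^ 15
    - ζ ^ 18) + v 0 * v 1 * v 4 * (-3 * ζ ^ 2 - 3 * ζ ^ 5 - 4 * ζ ^ 6 + 3 * ζ ^ 7 + 2 * ζ ^ 8 + ζ
    ^ 9 + 2 * ζ ^ 11 + ζ ^ 13 - ζ ^ 15 + ζ ^ 17 - ζ ^ 18 - ζ ^ 20) + v 0 * v 1 * v 3 * (-ζ ^ 2 - ζ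
    ^ 4 - ζ ^ 5 - ζ ^ 6 + ζ ^ 7 + ζ ^ 8 + 2 * ζ ^ 11 - ζ ^ 12 + ζ ^ 13 - ζ ^ 14 + ζ ^ 15 - ζ ^ 22)
    + v 0 * v 1 * v 2 * (2 * ζ ^ 1 - 3 * ζ ^ 2 + 3 * ζ ^ 3 - 2 * ζ ^ 4 - 3 * ζ ^ 5 - 3 * ζ ^ 6 + 3
    * ζ ^ 7 + 3 * ζ ^ 9 - 2 * ζ ^ 10 + 3 * ζ ^ 11 - 3 * ζ ^ 12 + 3 * ζ ^ 13 - ζ ^ 14 + ζ ^ 17 - 3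
    * ζ ^ 18 + ζ ^ 23) + v 0 * v 1 ^ 2 * (2 * ζ ^ 1 + 2 * ζ ^ 2 + 2 * ζ ^ 3 - 2 * ζ ^ 4 + 2 * ζ ^
    5 + ζ ^ 6 - ζ ^ 7 - 2 * ζ ^ 8 + 2 * ζ ^ 9 - 2 * ζ ^ 10 - 2 * ζ ^ 12 + 2 * ζ ^ 15 + ζ ^ 19 - ζ
    ^ 20) + v 0 ^ 2 * v 5 * (ζ ^ 1 + ζ ^ 3 - ζ ^ 4 - ζ ^ 6 + ζ ^ 9 - ζ ^ 12 + ζ ^ 13 + ζ ^ 16 - ζ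
    ^ 20) + v 0 ^ 2 * v 4 * (ζ ^ 1 + ζ ^ 2 + ζ ^ 3 - ζ ^ 4 + ζ ^ 5 + ζ ^ 6 - ζ ^ 7 - ζ ^ 8 + ζ ^ 9
    - ζ ^ 10 - ζ ^ 12 + ζ ^ 15) + v 0 ^ 2 * v 3 * (2 * ζ ^ 2 + 2 * ζ ^ 5 + 2 * ζ ^ 6 - ζ ^ 7 - 2 *
    ζ ^ 8 - ζ ^ 10 - ζ ^ 11 + ζ ^ 15 - ζ ^ 16 + ζ ^ 19) + v 0 ^ 2 * v 2 * (2 * ζ ^ 1 + 2 * ζ ^ 2 +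
    2 * ζ ^ 3 - 2 * ζ ^ 4 + 2 * ζ ^ 5 + ζ ^ 6 - ζ ^ 7 - 2 * ζ ^ 8 + 2 * ζ ^ 9 - 2 * ζ ^ 10 - 2 * ζ
    ^ 12 + 2 * ζ ^ 15 + ζ ^ 19 - ζ ^ 20) + v 0 ^ 2 * v 1 * (ζ ^ 1 - ζ ^ 2 + ζ ^ 3 - ζ ^ 4 - ζ ^ 6
    + ζ ^ 7 + ζ ^ 8 + 2 * ζ ^ 9 - 2 * ζ ^ 10 + ζ ^ 11 - 2 * ζ ^ 12 - ζ ^ 14 - ζ ^ 16 + ζ ^ 17 + ζ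
    ^ 21) + v 0 ^ 3 * (-ζ ^ 2 - ζ ^ 5 - ζ ^ 6 + ζ ^ 7 + ζ ^ 11 + ζ ^ 13 - ζ ^ 18)) * h

/-- The coordinates of `v` rescaled by the weights of the action of `T`. -/
def weightScale (y : ℂ) (v : Fin 6 → ℂ) : Fin 6 → ℂ :=
  ![y ^ 7 * v 0, y ^ 11 * v 1, y ^ 8 * v 2, y ^ 6 * v 3, y ^ 2 * v 4, y ^ 5 * v 5]

lemma DD0_weightScale {y : ℂ} (h : y ^ 13 = 1) (v : Fin 6 → ℂ) :
    DD0 (weightScale y v) = DD0 v := by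
  simp only [DD0, weightScale, Matrix.cons_val]
  linear_combination (
    v 0 * v 1 * v 2 * (y ^ 0 + y ^ 13)) * h

lemma DD1_weightScale {y : ℂ} (h : y ^ 13 = 1) (v : Fin 6 → ℂ) :
    DD1 (weightScale y v) = y * DD1 v := by
  simp only [DD1, weightScale, Matrix.cons_val]
  linear_combination (
    v 3 ^ 2 * v 4 * (-y ^ 1) + v 1 * v 2 ^ 2 * (2 * y ^ 1 + 2 * y ^ 14) + v 1 ^ 2 * v 5 * (y ^ 1 +
    y ^ 14) + v 0 * v 4 * v 5 * (y ^ 1)) * h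

lemma DD2_weightScale {y : ℂ} (h : y ^ 13 = 1) (v : Fin 6 → ℂ) :
    DD2 (weightScale y v) = y ^ 2 * DD2 v := by
  simp only [DD2, weightScale, Matrix.cons_val]
  linear_combination (
    v 5 ^ 3 * (-y ^ 2) + v 2 * v 4 * v 5 * (3 * y ^ 2) + v 1 * v 4 ^ 2 * (-2 * y ^ 2) + v 1 ^ 2 *
    v 3 * (y ^ 2 + y ^ 15) + v 0 * v 3 * v 4 * (y ^ 2)) * h

lemma DD3_weightScale {y : ℂ} (h : y ^ 13 = 1) (v : Fin 6 → ℂ) :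
    DD3 (weightScale y v) = y ^ 3 * DD3 v := by
  simp only [DD3, weightScale, Matrix.cons_val]
  linear_combination (
    v 3 * v 5 ^ 2 * (-y ^ 3) + v 2 * v 3 * v 4 * (y ^ 3) + v 0 * v 1 ^ 2 * (2 * y ^ 3 + 2 * y ^
    16) + v 0 ^ 2 * v 4 * (y ^ 3)) * h

lemma DD4_weightScale {y : ℂ} (h : y ^ 13 = 1) (v : Fin 6 → ℂ) :
    DD4 (weightScale y v) = y ^ 4 * DD4 v := by
  simp only [DD4, weightScale, Matrix.cons_val]
  linear_combination (
    v 3 ^ 2 * v 5 * (-2 * y ^ 4) + v 1 ^ 2 * v 2 * (-y ^ 4 - y ^ 17) + v 0 * v 5 ^ 2 * (y ^ 4) + v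
    0 * v 2 * v 4 * (-y ^ 4)) * h

lemma DD5_weightScale {y : ℂ} (h : y ^ 13 = 1) (v : Fin 6 → ℂ) :
    DD5 (weightScale y v) = y ^ 5 * DD5 v := by
  simp only [DD5, weightScale, Matrix.cons_val]
  linear_combination (
    v 3 ^ 3 * (-y ^ 5) + v 2 * v 5 ^ 2 * (-2 * y ^ 5) + v 2 ^ 2 * v 4 * (y ^ 5) + v 1 * v 4 * v 5
    * (y ^ 5) + v 0 * v 3 * v 5 * (3 * y ^ 5)) * h

lemma DD6_weightScale {y : ℂ} (h : y ^ 13 = 1) (v : Fin 6 → ℂ) :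
    DD6 (weightScale y v) = y ^ 6 * DD6 v := by
  simp only [DD6, weightScale, Matrix.cons_val]
  linear_combination (
    v 2 * v 3 * v 5 * (y ^ 6) + v 1 * v 3 * v 4 * (3 * y ^ 6) + v 0 * v 3 ^ 2 * (-2 * y ^ 6) + v 0
    ^ 2 * v 5 * (y ^ 6)) * h

lemma DD7_weightScale {y : ℂ} (h : y ^ 13 = 1) (v : Fin 6 → ℂ) :
    DD7 (weightScale y v) = y ^ 7 * DD7 v := by
  simp only [DD7, weightScale, Matrix.cons_val]
  linear_combination (
    v 2 * v 3 ^ 2 * (y ^ 7) + v 1 ^ 3 * (-y ^ 7 - y ^ 20) + v 0 * v 2 * v 5 * (-y ^ 7) + v 0 * v 1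
    * v 4 * (-3 * y ^ 7) + v 0 ^ 2 * v 3 * (2 * y ^ 7)) * h

lemma DD8_weightScale {y : ℂ} (h : y ^ 13 = 1) (v : Fin 6 → ℂ) :
    DD8 (weightScale y v) = y ^ 8 * DD8 v := by
  simp only [DD8, weightScale, Matrix.cons_val]
  linear_combination (
    v 2 ^ 2 * v 5 * (2 * y ^ 8) + v 1 * v 5 ^ 2 * (y ^ 8) + v 1 * v 2 * v 4 * (-y ^ 8) + v 0 * v 2
    * v 3 * (-3 * y ^ 8) + v 0 ^ 3 * (-y ^ 8)) * h

lemma DD9_weightScale {y : ℂ} (h : y ^ 13 = 1) (v : Fin 6 → ℂ) :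
    DD9 (weightScale y v) = y ^ 9 * DD9 v := by
  simp only [DD9, weightScale, Matrix.cons_val]
  linear_combination (
    v 2 ^ 2 * v 3 * (y ^ 9) + v 1 * v 3 * v 5 * (y ^ 9) + v 0 ^ 2 * v 2 * (2 * y ^ 9)) * h

lemma DD10_weightScale {y : ℂ} (h : y ^ 13 = 1) (v : Fin 6 → ℂ) :
    DD10 (weightScale y v) = y ^ 10 * DD10 v := by
  simp only [DD10, weightScale, Matrix.cons_val]
  linear_combination (
    v 1 * v 3 ^ 2 * (y ^ 10) + v 0 * v 2 ^ 2 * (-y ^ 10) + v 0 * v 1 * v 5 * (-y ^ 10)) * h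

lemma DD11_weightScale {y : ℂ} (h : y ^ 13 = 1) (v : Fin 6 → ℂ) :
    DD11 (weightScale y v) = y ^ 11 * DD11 v := by
  simp only [DD11, weightScale, Matrix.cons_val]
  linear_combination (
    v 2 ^ 3 * (-y ^ 11) + v 1 * v 2 * v 5 * (-3 * y ^ 11) + v 1 ^ 2 * v 4 * (2 * y ^ 11) + v 0 * v
    1 * v 3 * (-y ^ 11)) * h

lemma DD12_weightScale {y : ℂ} (h : y ^ 13 = 1) (v : Fin 6 → ℂ) :
    DD12 (weightScale y v) = y ^ 12 * DD12 v := by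
  simp only [DD12, weightScale, Matrix.cons_val]
  linear_combination (
    v 1 * v 2 * v 3 * (-y ^ 12) + v 0 ^ 2 * v 1 * (-y ^ 12)) * h

lemma DDinf_weightScale {y : ℂ} (h : y ^ 13 = 1) (v : Fin 6 → ℂ) :
    DDinf (weightScale y v) = DDinf v := by
  simp only [DDinf, weightScale, Matrix.cons_val]
  linear_combination (
    v 3 * v 4 * v 5 * (y ^ 0)) * h

lemma GG0_weightScale {y : ℂ} (h : y ^ 13 = 1) (v : Fin 6 → ℂ) :
    GG0 (weightScale y v) = GG0 v := by
  simp only [GG0,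
    DD0_weightScale h, DDinf_weightScale h]

lemma GG1_weightScale {y : ℂ} (h : y ^ 13 = 1) (v : Fin 6 → ℂ) :
    GG1 (weightScale y v) = y * GG1 v := by
  simp only [GG1,
    DD0_weightScale h, DD1_weightScale h, DD2_weightScale h, DD3_weightScale h, DD4_weightScale h,
    DD5_weightScale h, DD7_weightScale h, DD9_weightScale h, DD10_weightScale h, DD11_weightScale
    h, DD12_weightScale h, DDinf_weightScale h]
  linear_combination (
    DD7 v ^ 2 * (-1 * y ^ 1) + DD5 v * DD9 v * (-2 * y ^ 1) + DD4 v * DD10 v * (-4 * y ^ 1) + DD3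
    v * DD11 v * (-2 * y ^ 1) + DD2 v * DD12 v * (2 * y ^ 1)) * h

lemma GG2_weightScale {y : ℂ} (h : y ^ 13 = 1) (v : Fin 6 → ℂ) :
    GG2 (weightScale y v) = y ^ 2 * GG2 v := by
  simp only [GG2,
    DD0_weightScale h, DD1_weightScale h, DD2_weightScale h, DD4_weightScale h, DD5_weightScale h,
    DD6_weightScale h, DD7_weightScale h, DD8_weightScale h, DD9_weightScale h, DD10_weightScale
    h, DD11_weightScale h, DDinf_weightScale h]
  linear_combination (
    DD7 v * DD8 v * (-2 * y ^ 2) + DD6 v * DD9 v * (-2 * y ^ 2) + DD5 v * DD10 v * (2 * y ^ 2) +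
    DD4 v * DD11 v * (-2 * y ^ 2)) * h

lemma GG3_weightScale {y : ℂ} (h : y ^ 13 = 1) (v : Fin 6 → ℂ) :
    GG3 (weightScale y v) = y ^ 3 * GG3 v := by
  simp only [GG3,
    DD0_weightScale h, DD1_weightScale h, DD2_weightScale h, DD3_weightScale h, DD4_weightScale h,
    DD6_weightScale h, DD7_weightScale h, DD8_weightScale h, DD9_weightScale h, DD10_weightScale
    h, DD12_weightScale h, DDinf_weightScale h]
  linear_combination (
    DD8 v ^ 2 * (-1 * y ^ 3) + DD7 v * DD9 v * (-2 * y ^ 3) + DD6 v * DD10 v * (2 * y ^ 3) + DD4 v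
    * DD12 v * (-4 * y ^ 3)) * h

lemma GG4_weightScale {y : ℂ} (h : y ^ 13 = 1) (v : Fin 6 → ℂ) :
    GG4 (weightScale y v) = y ^ 4 * GG4 v := by
  simp only [GG4,
    DD0_weightScale h, DD1_weightScale h, DD2_weightScale h, DD3_weightScale h, DD4_weightScale h,
    DD5_weightScale h, DD7_weightScale h, DD8_weightScale h, DD9_weightScale h, DD10_weightScale
    h, DD12_weightScale h, DDinf_weightScale h]
  linear_combination (
    DD8 v * DD9 v * (-2 * y ^ 4) + DD7 v * DD10 v * (-2 * y ^ 4) + DD5 v * DD12 v * (2 * y ^ 4)) * h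

lemma GG5_weightScale {y : ℂ} (h : y ^ 13 = 1) (v : Fin 6 → ℂ) :
    GG5 (weightScale y v) = y ^ 5 * GG5 v := by
  simp only [GG5,
    DD0_weightScale h, DD2_weightScale h, DD3_weightScale h, DD5_weightScale h, DD6_weightScale h,
    DD7_weightScale h, DD8_weightScale h, DD9_weightScale h, DD10_weightScale h, DD11_weightScale
    h, DD12_weightScale h, DDinf_weightScale h]
  linear_combination (
    DD9 v ^ 2 * (-2 * y ^ 5) + DD8 v * DD10 v * (-2 * y ^ 5) + DD7 v * DD11 v * (-2 * y ^ 5) + DD6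
    v * DD12 v * (2 * y ^ 5)) * h

lemma GG6_weightScale {y : ℂ} (h : y ^ 13 = 1) (v : Fin 6 → ℂ) :
    GG6 (weightScale y v) = y ^ 6 * GG6 v := by
  simp only [GG6,
    DD0_weightScale h, DD1_weightScale h, DD2_weightScale h, DD3_weightScale h, DD4_weightScale h,
    DD5_weightScale h, DD6_weightScale h, DD7_weightScale h, DD8_weightScale h, DD11_weightScale
    h, DD12_weightScale h, DDinf_weightScale h]
  linear_combination (
    DD8 v * DD11 v * (-2 * y ^ 6) + DD7 v * DD12 v * (-2 * y ^ 6)) * h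

lemma GG7_weightScale {y : ℂ} (h : y ^ 13 = 1) (v : Fin 6 → ℂ) :
    GG7 (weightScale y v) = y ^ 7 * GG7 v := by
  simp only [GG7,
    DD0_weightScale h, DD1_weightScale h, DD2_weightScale h, DD5_weightScale h, DD6_weightScale h,
    DD7_weightScale h, DD8_weightScale h, DD9_weightScale h, DD10_weightScale h, DD11_weightScale
    h, DD12_weightScale h, DDinf_weightScale h]
  linear_combination (
    DD10 v ^ 2 * (-2 * y ^ 7) + DD9 v * DD11 v * (-2 * y ^ 7) + DD8 v * DD12 v * (-2 * y ^ 7)) * h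

lemma GG8_weightScale {y : ℂ} (h : y ^ 13 = 1) (v : Fin 6 → ℂ) :
    GG8 (weightScale y v) = y ^ 8 * GG8 v := by
  simp only [GG8,
    DD0_weightScale h, DD1_weightScale h, DD2_weightScale h, DD3_weightScale h, DD4_weightScale h,
    DD5_weightScale h, DD6_weightScale h, DD7_weightScale h, DD8_weightScale h, DD10_weightScale
    h, DD11_weightScale h, DDinf_weightScale h]
  linear_combination (
    DD10 v * DD11 v * (-2 * y ^ 8)) * h

lemma GG9_weightScale {y : ℂ} (h : y ^ 13 = 1) (v : Fin 6 → ℂ) :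
    GG9 (weightScale y v) = y ^ 9 * GG9 v := by
  simp only [GG9,
    DD0_weightScale h, DD1_weightScale h, DD3_weightScale h, DD4_weightScale h, DD5_weightScale h,
    DD6_weightScale h, DD8_weightScale h, DD9_weightScale h, DD10_weightScale h, DD11_weightScale
    h, DD12_weightScale h, DDinf_weightScale h]
  linear_combination (
    DD11 v ^ 2 * (-1 * y ^ 9) + DD10 v * DD12 v * (-4 * y ^ 9)) * h

lemma GG10_weightScale {y : ℂ} (h : y ^ 13 = 1) (v : Fin 6 → ℂ) :
    GG10 (weightScale y v) = y ^ 10 * GG10 v := by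
  simp only [GG10,
    DD0_weightScale h, DD1_weightScale h, DD3_weightScale h, DD4_weightScale h, DD5_weightScale h,
    DD6_weightScale h, DD7_weightScale h, DD9_weightScale h, DD10_weightScale h, DD11_weightScale
    h, DD12_weightScale h, DDinf_weightScale h]
  linear_combination (
    DD11 v * DD12 v * (-2 * y ^ 10)) * h

lemma GG11_weightScale {y : ℂ} (h : y ^ 13 = 1) (v : Fin 6 → ℂ) :
    GG11 (weightScale y v) = y ^ 11 * GG11 v := by
  simp only [GG11,
    DD0_weightScale h, DD2_weightScale h, DD3_weightScale h, DD4_weightScale h, DD5_weightScale h,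
    DD6_weightScale h, DD7_weightScale h, DD8_weightScale h, DD9_weightScale h, DD11_weightScale
    h, DD12_weightScale h, DDinf_weightScale h]
  linear_combination (
    DD12 v ^ 2 * (-2 * y ^ 11)) * h

lemma GG12_weightScale {y : ℂ} (h : y ^ 13 = 1) (v : Fin 6 → ℂ) :
    GG12 (weightScale y v) = y ^ 12 * GG12 v := by
  simp only [GG12,
    DD0_weightScale h, DD1_weightScale h, DD2_weightScale h, DD3_weightScale h, DD4_weightScale h,
    DD6_weightScale h, DD8_weightScale h, DD9_weightScale h, DD10_weightScale h, DD11_weightScale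
    h, DD12_weightScale h, DDinf_weightScale h]
  ring

lemma ζ_pow_thirteen : ζ ^ 13 = 1 := by
  rw [ζ, ← Complex.exp_nat_mul, Complex.exp_eq_one_iff]
  exact ⟨1, by push_cast; ring⟩

lemma ζ_ne_one : ζ ≠ 1 := by
  rw [ζ, Ne, Complex.exp_eq_one_iff]
  rintro ⟨n, hn⟩
  have h : (13 * n : ℂ) = 1 := by
    have := Complex.two_pi_I_ne_zero
    field_simp at hn
    linear_combination -hn
  have : 13 * n = 1 := by exact_mod_cast h
  omega

lemma ζ_geom_sum : 1 + ζ + ζ ^ 2 + ζ ^ 3 + ζ ^ 4 + ζ ^ 5 + ζ ^ 6 + ζ ^ 7 + ζ ^ 8 + ζ ^ 9 +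
    ζ ^ 10 + ζ ^ 11 + ζ ^ 12 = 0 := by
  have h : (ζ - 1) * (1 + ζ + ζ ^ 2 + ζ ^ 3 + ζ ^ 4 + ζ ^ 5 + ζ ^ 6 + ζ ^ 7 + ζ ^ 8 + ζ ^ 9 +
    ζ ^ 10 + ζ ^ 11 + ζ ^ 12) = 0 := by linear_combination ζ_pow_thirteen
  exact (mul_eq_zero.mp h).resolve_left (sub_ne_zero.mpr ζ_ne_one)

lemma quartic_periods_sq_add_sq :
    (ζ - ζ ^ 12 + ζ ^ 3 - ζ ^ 10 + ζ ^ 9 - ζ ^ 4) ^ 2 +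
      (ζ ^ 2 - ζ ^ 11 + ζ ^ 5 - ζ ^ 8 + ζ ^ 6 - ζ ^ 7) ^ 2 = -13 := by
  linear_combination ζ_geom_sum + (ζ ^ 11 + 3 * ζ ^ 9 - 2 * ζ ^ 8 + ζ ^ 7 + 3 * ζ ^ 5 - 2 * ζ ^ 4 +
    ζ ^ 3 + ζ - 12) * ζ_pow_thirteen

/-- The standard additive character of `ZMod 13`. -/
def ψ : AddChar (ZMod 13) ℂ := ZMod.stdAddChar

lemma ψ_natCast (n : ℕ) : ψ n = ζ ^ n := by
  have h := ZMod.stdAddChar_coe (N := 13) n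
  rw [ψ, ζ, ← Complex.exp_nat_mul]
  push_cast at h
  rw [h]
  congr 1
  ring

lemma ψ_eq_pow_val (a : ZMod 13) : ψ a = ζ ^ a.val := by
  rw [← ψ_natCast, ZMod.natCast_zmod_val]

/-- The odd function on `ZMod 13` attached to a vector of six coordinates. -/
def oddExt (v : Fin 6 → ℂ) : ZMod 13 → ℂ :=
  ![0, v 5, v 0, v 3, -v 4, v 2, v 1, -v 1, -v 2, v 4, -v 3, -v 0, -v 5]

/-- The six coordinates determining an odd function on `ZMod 13`. -/
def restr (X : ZMod 13 → ℂ) : Fin 6 → ℂ := ![X 2, X 6, X 5, X 3, X 9, X 1]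

/-- The finite Fourier transform with kernel `ψ (3 * r * s)`. -/
def fourier13 (X : ZMod 13 → ℂ) (r : ZMod 13) : ℂ := ∑ s, ψ (3 * r * s) * X s

/-- Multiplication by a quadratic character. -/
def chirp (ν : ZMod 13) (X : ZMod 13 → ℂ) (s : ZMod 13) : ℂ := ψ (5 * ν * s ^ 2) * X s

lemma restr_oddExt (v : Fin 6 → ℂ) : restr (oddExt v) = v := by
  ext i
  fin_cases i <;> rfl

lemma oddExt_restr {X : ZMod 13 → ℂ} (hX : ∀ s, X (-s) = -X s) : oddExt (restr X) = X := by
  have h0 : X 0 = 0 := by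
    have := hX 0
    rw [neg_zero] at this
    exact self_eq_neg.mp this
  ext s
  fin_cases s
  · exact h0.symm
  · rfl
  · rfl
  · rfl
  · exact (hX 9).symm
  · rfl
  · rfl
  · exact (hX 6).symm
  · exact (hX 5).symm
  · rfl
  · exact (hX 3).symm
  · exact (hX 2).symm
  · exact (hX 1).symm

lemma oddExt_neg (v : Fin 6 → ℂ) (s : ZMod 13) : oddExt v (-s) = -oddExt v s := by
  fin_cases s
  · exact neg_zero.symm
  · rfl
  · rfl
  · rfl
  · exact (neg_neg _).symm
  · rfl
  · rfl
  · exact (neg_neg _).symm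
  · exact (neg_neg _).symm
  · rfl
  · exact (neg_neg _).symm
  · exact (neg_neg _).symm
  · exact (neg_neg _).symm

lemma fourier13_oddExt (v : Fin 6 → ℂ) (r : ZMod 13) :
    fourier13 (oddExt v) r =
      (ψ (3 * r * 2) - ψ (3 * r * 11)) * v 0 + (ψ (3 * r * 6) - ψ (3 * r * 7)) * v 1 +
      (ψ (3 * r * 5) - ψ (3 * r * 8)) * v 2 + (ψ (3 * r * 3) - ψ (3 * r * 10)) * v 3 +
      (ψ (3 * r * 9) - ψ (3 * r * 4)) * v 4 + (ψ (3 * r * 1) - ψ (3 * r * 12)) * v 5 := by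
  have h : ∀ f : ZMod 13 → ℂ, ∑ s, f s = f 0 + f 1 + f 2 + f 3 + f 4 + f 5 + f 6 + f 7 + f 8 +
      f 9 + f 10 + f 11 + f 12 := fun f => Fin.sum_univ_castSucc _ |>.trans (by
        simp only [Fin.sum_univ_castSucc, Finset.univ_eq_empty, Finset.sum_empty, zero_add]; rfl)
  rw [fourier13, h]
  change ψ (3 * r * 0) * 0 + _ * v 5 + _ * v 0 + _ * v 3 + _ * (-v 4) + _ * v 2 + _ * v 1 +
    _ * (-v 1) + _ * (-v 2) + _ * v 4 + _ * (-v 3) + _ * (-v 0) + _ * (-v 5) = _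
  ring

lemma fourier13_oddExt_two (v : Fin 6 → ℂ) : fourier13 (oddExt v) 2 =
      (ζ ^ 12 - ζ) * v 0 + (ζ ^ 10 - ζ ^ 3) * v 1 + (ζ ^ 4 - ζ ^ 9) * v 2 + (ζ ^ 5 - ζ ^ 8) * v 3
      + (ζ ^ 2 - ζ ^ 11) * v 4 + (ζ ^ 6 - ζ ^ 7) * v 5 := by
  simp only [fourier13_oddExt, ψ_eq_pow_val]
  change
    (ζ ^ 12 - ζ ^ 1) * v 0 + (ζ ^ 10 - ζ ^ 3) * v 1 + (ζ ^ 4 - ζ ^ 9) * v 2 + (ζ ^ 5 - ζ ^ 8) * v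
    3 + (ζ ^ 2 - ζ ^ 11) * v 4 + (ζ ^ 6 - ζ ^ 7) * v 5 = _
  rw [pow_one]

lemma fourier13_oddExt_six (v : Fin 6 → ℂ) : fourier13 (oddExt v) 6 =
      (ζ ^ 10 - ζ ^ 3) * v 0 + (ζ ^ 4 - ζ ^ 9) * v 1 + (ζ ^ 12 - ζ) * v 2 + (ζ ^ 2 - ζ ^ 11) * v 3
      + (ζ ^ 6 - ζ ^ 7) * v 4 + (ζ ^ 5 - ζ ^ 8) * v 5 := by
  simp only [fourier13_oddExt, ψ_eq_pow_val]
  change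
    (ζ ^ 10 - ζ ^ 3) * v 0 + (ζ ^ 4 - ζ ^ 9) * v 1 + (ζ ^ 12 - ζ ^ 1) * v 2 + (ζ ^ 2 - ζ ^ 11) * v
    3 + (ζ ^ 6 - ζ ^ 7) * v 4 + (ζ ^ 5 - ζ ^ 8) * v 5 = _
  rw [pow_one]

lemma fourier13_oddExt_five (v : Fin 6 → ℂ) : fourier13 (oddExt v) 5 =
      (ζ ^ 4 - ζ ^ 9) * v 0 + (ζ ^ 12 - ζ) * v 1 + (ζ ^ 10 - ζ ^ 3) * v 2 + (ζ ^ 6 - ζ ^ 7) * v 3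
      + (ζ ^ 5 - ζ ^ 8) * v 4 + (ζ ^ 2 - ζ ^ 11) * v 5 := by
  simp only [fourier13_oddExt, ψ_eq_pow_val]
  change
    (ζ ^ 4 - ζ ^ 9) * v 0 + (ζ ^ 12 - ζ ^ 1) * v 1 + (ζ ^ 10 - ζ ^ 3) * v 2 + (ζ ^ 6 - ζ ^ 7) * v
    3 + (ζ ^ 5 - ζ ^ 8) * v 4 + (ζ ^ 2 - ζ ^ 11) * v 5 = _
  rw [pow_one]

lemma fourier13_oddExt_three (v : Fin 6 → ℂ) : fourier13 (oddExt v) 3 =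
      (ζ ^ 5 - ζ ^ 8) * v 0 + (ζ ^ 2 - ζ ^ 11) * v 1 + (ζ ^ 6 - ζ ^ 7) * v 2 + (ζ - ζ ^ 12) * v 3
      + (ζ ^ 3 - ζ ^ 10) * v 4 + (ζ ^ 9 - ζ ^ 4) * v 5 := by
  simp only [fourier13_oddExt, ψ_eq_pow_val]
  change
    (ζ ^ 5 - ζ ^ 8) * v 0 + (ζ ^ 2 - ζ ^ 11) * v 1 + (ζ ^ 6 - ζ ^ 7) * v 2 + (ζ ^ 1 - ζ ^ 12) * v
    3 + (ζ ^ 3 - ζ ^ 10) * v 4 + (ζ ^ 9 - ζ ^ 4) * v 5 = _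
  rw [pow_one]

lemma fourier13_oddExt_nine (v : Fin 6 → ℂ) : fourier13 (oddExt v) 9 =
      (ζ ^ 2 - ζ ^ 11) * v 0 + (ζ ^ 6 - ζ ^ 7) * v 1 + (ζ ^ 5 - ζ ^ 8) * v 2 + (ζ ^ 3 - ζ ^ 10) *
      v 3 + (ζ ^ 9 - ζ ^ 4) * v 4 + (ζ - ζ ^ 12) * v 5 := by
  simp only [fourier13_oddExt, ψ_eq_pow_val]
  change
    (ζ ^ 2 - ζ ^ 11) * v 0 + (ζ ^ 6 - ζ ^ 7) * v 1 + (ζ ^ 5 - ζ ^ 8) * v 2 + (ζ ^ 3 - ζ ^ 10) * v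
    3 + (ζ ^ 9 - ζ ^ 4) * v 4 + (ζ ^ 1 - ζ ^ 12) * v 5 = _
  rw [pow_one]

lemma fourier13_oddExt_one (v : Fin 6 → ℂ) : fourier13 (oddExt v) 1 =
      (ζ ^ 6 - ζ ^ 7) * v 0 + (ζ ^ 5 - ζ ^ 8) * v 1 + (ζ ^ 2 - ζ ^ 11) * v 2 + (ζ ^ 9 - ζ ^ 4) * v
      3 + (ζ - ζ ^ 12) * v 4 + (ζ ^ 3 - ζ ^ 10) * v 5 := by
  simp only [fourier13_oddExt, ψ_eq_pow_val]
  change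
    (ζ ^ 6 - ζ ^ 7) * v 0 + (ζ ^ 5 - ζ ^ 8) * v 1 + (ζ ^ 2 - ζ ^ 11) * v 2 + (ζ ^ 9 - ζ ^ 4) * v 3
    + (ζ ^ 1 - ζ ^ 12) * v 4 + (ζ ^ 3 - ζ ^ 10) * v 5 = _
  rw [pow_one]

lemma GG0_of_cubic_transform {A B : ℂ} (h : A ^ 2 + B ^ 2 = -13) {v w : Fin 6 → ℂ}
    (h0 : DD0 w = -((-2 * A + 3 * B) * DD0 v + (3 * A + 2 * B) * DDinf v -
      (A + B) * (DD1 v + DD3 v + DD9 v) - A * (DD2 v + DD5 v + DD6 v) -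
      B * (DD7 v + DD8 v + DD11 v) + (A - B) * (DD4 v + DD10 v + DD12 v)))
    (h1 : DDinf w = -((3 * A + 2 * B) * DD0 v + (2 * A - 3 * B) * DDinf v +
      (-A + B) * (DD1 v + DD3 v + DD9 v) + B * (DD2 v + DD5 v + DD6 v) -
      A * (DD7 v + DD8 v + DD11 v) - (A + B) * (DD4 v + DD10 v + DD12 v))) :
    GG0 w = 13 * (-13 * GG0 v + GG1 v + GG2 v + GG3 v + GG4 v + GG5 v + GG6 v + GG7 v + GG8 v +
      GG9 v + GG10 v + GG11 v + GG12 v) := by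
  unfold GG0 GG1 GG2 GG3 GG4 GG5 GG6 GG7 GG8 GG9 GG10 GG11 GG12
  rw [h0, h1]
  generalize DD0 v = x0, DD1 v = x1, DD2 v = x2, DD3 v = x3, DD4 v = x4, DD5 v = x5, DD6 v = x6,
    DD7 v = x7, DD8 v = x8, DD9 v = x9, DD10 v = x10, DD11 v = x11, DD12 v = x12, DDinf v = y
  linear_combination ((-2 * x0 + 3 * y - x1 - x3 - x9 - x2 - x5 - x6 + x4 + x10 + x12) ^ 2 +
    (3 * x0 + 2 * y - x1 - x3 - x9 - x7 - x8 - x11 - x4 - x10 - x12) ^ 2) * h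

/-- The action of `ν ↦ 2ν` on coordinates, exchanging the two orbits of squares. -/
def orbitSwap (v : Fin 6 → ℂ) : Fin 6 → ℂ := ![-v 4, -v 5, -v 3, v 1, v 2, v 0]

lemma DD0_fourier (v : Fin 6 → ℂ) :
    DD0 (restr (fourier13 (oddExt v))) =
      fourier13 (oddExt v) 2 * fourier13 (oddExt v) 6 * fourier13 (oddExt v) 5 := rfl

lemma DDinf_fourier (v : Fin 6 → ℂ) :
    DDinf (restr (fourier13 (oddExt v))) =
      fourier13 (oddExt (orbitSwap v)) 2 * fourier13 (oddExt (orbitSwap v)) 6 *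
        fourier13 (oddExt (orbitSwap v)) 5 := by
  change fourier13 (oddExt v) 3 * fourier13 (oddExt v) 9 * fourier13 (oddExt v) 1 = _
  rw [fourier13_oddExt_three, fourier13_oddExt_nine, fourier13_oddExt_one,
    fourier13_oddExt_two, fourier13_oddExt_six, fourier13_oddExt_five]
  simp only [orbitSwap, Matrix.cons_val]
  ring

lemma GG0_fourier (v : Fin 6 → ℂ) : GG0 (restr (fourier13 (oddExt v))) = 13 * dF 0 v := by
  rw [GG0_of_cubic_transform quartic_periods_sq_add_sq (v := v)]
  · simp only [dF, mul_zero, pow_zero, one_mul]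
  · rw [DD0_fourier, fourier13_oddExt_two, fourier13_oddExt_six, fourier13_oddExt_five,
      sine_product_expansion ζ_pow_thirteen]
  · rw [DDinf_fourier, fourier13_oddExt_two, fourier13_oddExt_six, fourier13_oddExt_five,
      sine_product_expansion ζ_pow_thirteen]
    simp only [orbitSwap, DD0, DD1, DD2, DD3, DD4, DD5, DD6, DD7, DD8, DD9, DD10, DD11, DD12,
      DDinf, Matrix.cons_val]
    ring

lemma dF_eq_dF_zero_weightScale (n : ℕ) (v : Fin 6 → ℂ) :
    dF n v = dF 0 (weightScale (ζ ^ n) v) := by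
  have h : (ζ ^ n) ^ 13 = 1 := by rw [← pow_mul, mul_comm, pow_mul, ζ_pow_thirteen, one_pow]
  simp only [dF, GG0_weightScale h, GG1_weightScale h, GG2_weightScale h, GG3_weightScale h,
    GG4_weightScale h, GG5_weightScale h, GG6_weightScale h, GG7_weightScale h,
    GG8_weightScale h, GG9_weightScale h, GG10_weightScale h, GG11_weightScale h,
    GG12_weightScale h, ← pow_mul]
  ring

lemma dF_congr_of_modEq {m n : ℕ} (h : m ≡ n [MOD 13]) (v : Fin 6 → ℂ) : dF m v = dF n v := by
  have : ζ ^ m = ζ ^ n := by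
    rw [← ψ_natCast, ← ψ_natCast, (ZMod.natCast_eq_natCast_iff m n 13).mpr h]
  rw [dF_eq_dF_zero_weightScale, this, ← dF_eq_dF_zero_weightScale]

lemma dF_add (m n : ℕ) (v : Fin 6 → ℂ) : dF m (weightScale (ζ ^ n) v) = dF (m + n) v := by
  rw [dF_eq_dF_zero_weightScale, dF_eq_dF_zero_weightScale (m + n), pow_add]
  congr 1
  ext i
  fin_cases i <;> simp [weightScale] <;> ring

lemma weightScale_eq_restr_chirp (n : ℕ) (v : Fin 6 → ℂ) :
    weightScale (ζ ^ n) v = restr (chirp n (oddExt v)) := by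
  have h : ∀ (k : ℕ) (s : ZMod 13), (k : ZMod 13) = 5 * s ^ 2 →
      ψ (5 * n * s ^ 2) = (ζ ^ n) ^ k := fun k s hk => by
    rw [← pow_mul, ← ψ_natCast, Nat.cast_mul, hk]
    congr 1
    ring
  ext i
  fin_cases i
  · change (ζ ^ n) ^ 7 * v 0 = ψ (5 * n * 2 ^ 2) * v 0; rw [h 7 2 rfl]
  · change (ζ ^ n) ^ 11 * v 1 = ψ (5 * n * 6 ^ 2) * v 1; rw [h 11 6 rfl]
  · change (ζ ^ n) ^ 8 * v 2 = ψ (5 * n * 5 ^ 2) * v 2; rw [h 8 5 rfl]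
  · change (ζ ^ n) ^ 6 * v 3 = ψ (5 * n * 3 ^ 2) * v 3; rw [h 6 3 rfl]
  · change (ζ ^ n) ^ 2 * v 4 = ψ (5 * n * 9 ^ 2) * v 4; rw [h 2 9 rfl]
  · change (ζ ^ n) ^ 5 * v 5 = ψ (5 * n * 1 ^ 2) * v 5; rw [h 5 1 rfl]

lemma dF_val_eq (ν : ZMod 13) (v : Fin 6 → ℂ) :
    dF ν.val v = dF 0 (restr (chirp ν (oddExt v))) := by
  rw [dF_eq_dF_zero_weightScale, weightScale_eq_restr_chirp, ZMod.natCast_zmod_val]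

/-- The quadratic Gauss sum of `ψ (5 * ν * s ^ 2)`. -/
def gaussSum13 (ν : ZMod 13) : ℂ := ∑ s, ψ (5 * ν * s ^ 2)

lemma sum_ψ_mul (b : ZMod 13) : ∑ x, ψ (x * b) = if b = 0 then 13 else 0 := by
  have := AddChar.sum_mulShift b (ZMod.isPrimitive_stdAddChar 13)
  rw [ZMod.card] at this
  exact_mod_cast this

instance : Fact (Nat.Prime 13) := ⟨by norm_num⟩

lemma gaussSum13_sq {ν : ZMod 13} (hν : ν ≠ 0) : gaussSum13 ν ^ 2 = 13 := by
  have e : ∑ s, ∑ t, ψ (5 * ν * s ^ 2) * ψ (5 * ν * t ^ 2) =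
      ∑ u : ZMod 13, ∑ t : ZMod 13, ψ (t * (ν * (50 * u)) + 5 * ν * u ^ 2) := by
    rw [Finset.sum_comm, Finset.sum_comm (f := fun u t => ψ (t * (ν * (50 * u)) + 5 * ν * u ^ 2))]
    refine Finset.sum_congr rfl fun t _ => ?_
    rw [← Equiv.sum_comp (Equiv.addRight (5 * t))]
    refine Finset.sum_congr rfl fun u _ => ?_
    rw [← AddChar.map_add_eq_mul]
    congr 1
    have : (26 : ZMod 13) = 0 := rfl
    simp only [Equiv.coe_addRight]
    linear_combination 5 * ν * t ^ 2 * this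
  rw [sq, gaussSum13, Finset.sum_mul_sum, e]
  simp only [AddChar.map_add_eq_mul, ← Finset.sum_mul, sum_ψ_mul]
  rw [Finset.sum_eq_single 0]
  · simp
  · intro u _ hu
    have h50 : (50 : ZMod 13) ≠ 0 := by decide
    rw [if_neg (mul_ne_zero hν (mul_ne_zero h50 hu)), zero_mul]
  · simp

lemma fourier13_fourier13 (X : ZMod 13 → ℂ) (r : ZMod 13) :
    fourier13 (fourier13 X) r = 13 * X (-r) := by
  simp only [fourier13, Finset.mul_sum]
  rw [Finset.sum_comm]
  have : ∀ t s : ZMod 13, ψ (3 * r * s) * (ψ (3 * s * t) * X t) = ψ (s * (3 * (r + t))) * X t := by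
    intro t s
    rw [← mul_assoc, ← AddChar.map_add_eq_mul]
    congr 2
    ring
  simp only [this, ← Finset.sum_mul, sum_ψ_mul]
  rw [Finset.sum_eq_single (-r)]
  · simp
  · intro t _ ht
    have h3 : (3 : ZMod 13) ≠ 0 := by decide
    rw [if_neg, zero_mul]
    exact mul_ne_zero h3 fun h => ht (by linear_combination h)
  · simp

lemma fourier13_chirp_fourier13 {μ ν : ZMod 13} (h : μ * ν = -1) (X : ZMod 13 → ℂ)
    (r : ZMod 13) :
    fourier13 (chirp ν (fourier13 X)) r =
      gaussSum13 ν * (ψ (5 * μ * r ^ 2) * fourier13 (chirp μ X) (-μ * r)) := by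
  have h13 : (13 : ZMod 13) = 0 := rfl
  simp only [fourier13, chirp, gaussSum13, Finset.mul_sum, Finset.sum_mul]
  rw [Finset.sum_comm]
  refine Finset.sum_congr rfl fun t _ => ?_
  simp only [← mul_assoc, ← AddChar.map_add_eq_mul, ← Finset.sum_mul]
  congr 1
  rw [← Equiv.sum_comp (Equiv.addRight (-(μ * (r + t))))]
  refine Finset.sum_congr rfl fun s _ => congrArg ψ ?_
  simp only [Equiv.coe_addRight]
  linear_combination (-10 * s * (r + t) + 5 * μ * (r + t) ^ 2) * h +
    (s * (r + t) - μ * (r ^ 2 + t ^ 2 + r * t)) * h13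

lemma fourier13_odd {X : ZMod 13 → ℂ} (hX : ∀ s, X (-s) = -X s) (r : ZMod 13) :
    fourier13 X (-r) = -fourier13 X r := by
  rw [fourier13, fourier13, ← Equiv.sum_comp (Equiv.neg _), ← Finset.sum_neg_distrib]
  refine Finset.sum_congr rfl fun s _ => ?_
  simp only [Equiv.neg_apply, hX, mul_neg, neg_mul, neg_neg]

lemma chirp_odd {X : ZMod 13 → ℂ} (hX : ∀ s, X (-s) = -X s) (ν s : ZMod 13) :
    chirp ν X (-s) = -chirp ν X s := by
  rw [chirp, chirp, neg_sq, hX, mul_neg]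

lemma GG0_restr_dilate {X : ZMod 13 → ℂ} (hX : ∀ s, X (-s) = -X s) {k : ZMod 13} (hk : k ≠ 0) :
    GG0 (restr fun s => X (k * s)) = GG0 (restr X) := by
  have h12 := hX 1
  have h11 := hX 2
  have h10 := hX 3
  have h4 := hX 9
  have h8 := hX 5
  have h7 := hX 6
  change X 12 = _ at h12
  change X 11 = _ at h11
  change X 10 = _ at h10
  change X 4 = _ at h4
  change X 8 = _ at h8
  change X 7 = _ at h7
  have e : ∀ k, GG0 (restr fun s => X (k * s)) =
    (X (k * 2) * X (k * 6) * X (k * 5)) ^ 2 + (X (k * 3) * X (k * 9) * X (k * 1)) ^ 2 :=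
    fun _ => rfl
  have e1 : GG0 (restr X) = (X 2 * X 6 * X 5) ^ 2 + (X 3 * X 9 * X 1) ^ 2 := rfl
  rw [e, e1]
  fin_cases k
  · exact absurd rfl hk
  · change (X 2 * X 6 * X 5) ^ 2 + (X 3 * X 9 * X 1) ^ 2 = _; ring
  · change (X 4 * X 12 * X 10) ^ 2 + (X 6 * X 5 * X 2) ^ 2 = _; rw [h4, h12, h10]; ring
  · change (X 6 * X 5 * X 2) ^ 2 + (X 9 * X 1 * X 3) ^ 2 = _; ring
  · change (X 8 * X 11 * X 7) ^ 2 + (X 12 * X 10 * X 4) ^ 2 = _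
    rw [h8, h11, h7, h12, h10, h4]; ring
  · change (X 10 * X 4 * X 12) ^ 2 + (X 2 * X 6 * X 5) ^ 2 = _; rw [h10, h4, h12]; ring
  · change (X 12 * X 10 * X 4) ^ 2 + (X 5 * X 2 * X 6) ^ 2 = _; rw [h12, h10, h4]; ring
  · change (X 1 * X 3 * X 9) ^ 2 + (X 8 * X 11 * X 7) ^ 2 = _; rw [h8, h11, h7]; ring
  · change (X 3 * X 9 * X 1) ^ 2 + (X 11 * X 7 * X 8) ^ 2 = _; rw [h11, h7, h8]; ring
  · change (X 5 * X 2 * X 6) ^ 2 + (X 1 * X 3 * X 9) ^ 2 = _; ring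
  · change (X 7 * X 8 * X 11) ^ 2 + (X 4 * X 12 * X 10) ^ 2 = _
    rw [h7, h8, h11, h4, h12, h10]; ring
  · change (X 9 * X 1 * X 3) ^ 2 + (X 7 * X 8 * X 11) ^ 2 = _; rw [h7, h8, h11]; ring
  · change (X 11 * X 7 * X 8) ^ 2 + (X 10 * X 4 * X 12) ^ 2 = _
    rw [h11, h7, h8, h10, h4, h12]; ring

lemma GG0_restr_chirp {X : ZMod 13 → ℂ} (hX : ∀ s, X (-s) = -X s) (μ : ZMod 13) :
    GG0 (restr (chirp μ X)) = GG0 (restr X) := by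
  have h : (ζ ^ μ.val) ^ 13 = 1 := by rw [← pow_mul, mul_comm, pow_mul, ζ_pow_thirteen, one_pow]
  rw [← GG0_weightScale h (restr X), weightScale_eq_restr_chirp, oddExt_restr hX,
    ZMod.natCast_zmod_val]

lemma restr_smul (c : ℂ) (X : ZMod 13 → ℂ) : restr (c • X) = c • restr X := by
  ext i; fin_cases i <;> rfl

lemma oddExt_smul (c : ℂ) (v : Fin 6 → ℂ) : oddExt (c • v) = c • oddExt v := by
  rw [← oddExt_restr (X := c • oddExt v), restr_smul, restr_oddExt]
  intro s
  simp only [Pi.smul_apply, oddExt_neg, smul_neg]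

lemma GG0_smul (c : ℂ) (v : Fin 6 → ℂ) : GG0 (c • v) = c ^ 6 * GG0 v := by
  simp only [GG0, DD0, DDinf, Pi.smul_apply, smul_eq_mul]
  ring

lemma dInf_smul (c : ℂ) (v : Fin 6 → ℂ) : dInf (c • v) = c ^ 6 * dInf v := by
  simp only [dInf, GG0_smul]
  ring

lemma fourier13_smul (c : ℂ) (X : ZMod 13 → ℂ) : fourier13 (c • X) = c • fourier13 X := by
  ext r
  simp only [fourier13, Pi.smul_apply, smul_eq_mul, Finset.mul_sum]
  exact Finset.sum_congr rfl fun s _ => by ring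

lemma chirp_smul (c : ℂ) (ν : ZMod 13) (X : ZMod 13 → ℂ) : chirp ν (c • X) = c • chirp ν X := by
  ext s
  simp only [chirp, Pi.smul_apply, smul_eq_mul]
  ring

lemma dF_zero_smul (c : ℂ) (v : Fin 6 → ℂ) : dF 0 (c • v) = c ^ 6 * dF 0 v := by
  have h := GG0_fourier (c • v)
  rw [oddExt_smul, fourier13_smul, restr_smul, GG0_smul, GG0_fourier] at h
  linear_combination -h / 13

lemma dF_smul (n : ℕ) (c : ℂ) (v : Fin 6 → ℂ) : dF n (c • v) = c ^ 6 * dF n v := by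
  rw [dF_eq_dF_zero_weightScale, dF_eq_dF_zero_weightScale n v, weightScale_eq_restr_chirp,
    oddExt_smul, chirp_smul, restr_smul, dF_zero_smul, ← weightScale_eq_restr_chirp]

lemma dF_zero_fourier (v : Fin 6 → ℂ) :
    dF 0 (restr (fourier13 (oddExt v))) = 13 ^ 3 * dInf v := by
  have h := GG0_fourier (restr (fourier13 (oddExt v)))
  rw [oddExt_restr (fourier13_odd (oddExt_neg v))] at h
  have e : fourier13 (fourier13 (oddExt v)) = (-13 : ℂ) • oddExt v := by
    ext r
    rw [fourier13_fourier13, oddExt_neg, Pi.smul_apply, smul_eq_mul]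
    ring
  rw [e, restr_smul, restr_oddExt, GG0_smul] at h
  rw [dInf]
  linear_combination -h / 13

lemma dInf_fourier (v : Fin 6 → ℂ) :
    dInf (restr (fourier13 (oddExt v))) = 13 ^ 3 * dF 0 v := by
  rw [dInf, GG0_fourier]
  ring

lemma dF_fourier {μ ν : ZMod 13} (h : μ * ν = -1) (v : Fin 6 → ℂ) :
    dF ν.val (restr (fourier13 (oddExt v))) = 13 ^ 3 * dF μ.val v := by
  have hν : ν ≠ 0 := by rintro rfl; simp at h
  have hμ : -μ ≠ 0 := by rintro h0; rw [neg_eq_zero] at h0; subst h0; simp at h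
  have hX := oddExt_neg v
  have hc := fourier13_odd (chirp_odd hX μ)
  rw [dF_val_eq, dF_val_eq, oddExt_restr (fourier13_odd hX)]
  have h1 := GG0_fourier (restr (chirp ν (fourier13 (oddExt v))))
  have h2 := GG0_fourier (restr (chirp μ (oddExt v)))
  rw [oddExt_restr (chirp_odd (fourier13_odd hX) ν)] at h1
  rw [oddExt_restr (chirp_odd hX μ)] at h2
  have e : fourier13 (chirp ν (fourier13 (oddExt v))) = gaussSum13 ν •
      chirp μ fun r => fourier13 (chirp μ (oddExt v)) (-μ * r) :=
    funext fun r => fourier13_chirp_fourier13 h _ r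
  rw [e, restr_smul, GG0_smul, GG0_restr_chirp (fun s => by rw [mul_neg, hc]),
    GG0_restr_dilate hc hμ, h2, show gaussSum13 ν ^ 6 = (gaussSum13 ν ^ 2) ^ 3 by ring,
    gaussSum13_sq hν] at h1
  linear_combination -h1 / 13

lemma Phi30_eq_sum_zmod (v : Fin 6 → ℂ) : Phi30 v =
    -(1 / (13 * 1315) : ℂ) * ((∑ ν : ZMod 13, dF ν.val v ^ 5) + dInf v ^ 5) := by
  rw [Phi30, Finset.sum_range]
  rfl

lemma Phi30_smul (c : ℂ) (v : Fin 6 → ℂ) : Phi30 (c • v) = c ^ 30 * Phi30 v := by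
  simp only [Phi30, dF_smul, dInf_smul, mul_pow, ← Finset.mul_sum]
  ring

lemma Phi30_weightScale (v : Fin 6 → ℂ) : Phi30 (weightScale ζ v) = Phi30 v := by
  have hI : dInf (weightScale ζ v) = dInf v := by
    rw [dInf, dInf, GG0_weightScale ζ_pow_thirteen]
  have h := fun n => dF_add n 1 v
  simp only [pow_one] at h
  rw [Phi30, Phi30, hI]
  simp only [h]
  rw [Finset.sum_range_succ, Finset.sum_range_succ' (fun ν => dF ν v ^ 5),
    dF_congr_of_modEq (show 12 + 1 ≡ 0 [MOD 13] from rfl)]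

lemma Phi30_fourier (v : Fin 6 → ℂ) :
    Phi30 (restr (fourier13 (oddExt v))) = 13 ^ 15 * Phi30 v := by
  rw [Phi30_eq_sum_zmod, Phi30_eq_sum_zmod, ← Finset.add_sum_erase _ _ (Finset.mem_univ 0),
    ← Finset.add_sum_erase _ (fun ν : ZMod 13 => dF ν.val v ^ 5) (Finset.mem_univ 0)]
  have : ∑ ν ∈ Finset.univ.erase (0 : ZMod 13), dF ν.val (restr (fourier13 (oddExt v))) ^ 5 =
      13 ^ 15 * ∑ ν ∈ Finset.univ.erase (0 : ZMod 13), dF ν.val v ^ 5 := by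
    rw [Finset.mul_sum]
    refine Finset.sum_nbij' (fun ν => -ν⁻¹) (fun ν => -ν⁻¹) ?_ ?_ ?_ ?_ ?_
    · intro ν hν
      simpa using hν
    · intro ν hν
      simpa using hν
    · intro ν _
      simp [inv_neg]
    · intro ν _
      simp [inv_neg]
    · intro ν hν
      rw [Finset.mem_erase] at hν
      rw [dF_fourier (μ := -ν⁻¹) (by rw [neg_mul, inv_mul_cancel₀ hν.1])]
      ring
  rw [this, ZMod.val_zero, dF_zero_fourier, dInf_fourier]
  ring

/-- The general term of the theta series `∑ (-1) ^ l * q ^ ((2 * l + 1) ^ 2 / 104)`. -/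
def thetaTerm (z : ℂ) (l : ℤ) : ℂ :=
  (-1) ^ l * exp (2 * Real.pi * I * ((2 * l + 1) ^ 2 / 104) * z)

/-- The theta constants of order 13, collected in an odd function on `ZMod 13`. -/
def oddTheta (z : ℂ) (r : ZMod 13) : ℂ :=
  ∑' l : ℤ, if ((2 * l + 1 : ℤ) : ZMod 13) = r then thetaTerm z l else 0

lemma neg_one_zpow_eq_exp (l : ℤ) : (-1 : ℂ) ^ l = exp (Real.pi * I * l) := by
  rw [← exp_pi_mul_I, ← Complex.exp_int_mul, mul_comm]

lemma exp_mul_thetaTerm (a z : ℂ) (l : ℤ) :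
    exp (2 * Real.pi * I * a * (2 * l + 1)) * thetaTerm z l =
      exp (2 * Real.pi * I * a + Real.pi * I * z / 52) *
        jacobiTheta₂_term l (1 / 2 + 2 * a + z / 26) (z / 13) := by
  rw [thetaTerm, neg_one_zpow_eq_exp, jacobiTheta₂_term]
  simp only [← Complex.exp_add]
  congr 1
  ring

lemma summable_thetaTerm {z : ℂ} (hz : 0 < z.im) : Summable (thetaTerm z) := by
  have h := exp_mul_thetaTerm 0 z
  simp only [mul_zero, zero_mul, exp_zero, one_mul, add_zero, zero_add] at h
  rw [funext h]
  refine ((summable_jacobiTheta₂_term_iff _ _).mpr ?_).mul_left _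
  rw [show z / 13 = z / (13 : ℝ) by norm_num, Complex.div_ofReal_im]
  positivity

lemma summable_oddTheta {z : ℂ} (hz : 0 < z.im) (r : ZMod 13) :
    Summable fun l : ℤ => if ((2 * l + 1 : ℤ) : ZMod 13) = r then thetaTerm z l else 0 :=
  ((summable_thetaTerm hz).indicator {l : ℤ | ((2 * l + 1 : ℤ) : ZMod 13) = r}).congr
    fun l => by simp [Set.indicator_apply]

lemma thetaTerm_neg_one_sub (z : ℂ) (l : ℤ) : thetaTerm z (-1 - l) = -thetaTerm z l := by
  have h : (-1 : ℂ) ^ (-1 - l) = -(-1) ^ l := by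
    rw [sub_eq_add_neg, zpow_add₀ (by norm_num), zpow_neg, ← inv_zpow, zpow_neg, ← inv_zpow,
      inv_neg_one, zpow_one, neg_one_mul]
  rw [thetaTerm, thetaTerm, h, neg_mul]
  congr 4
  push_cast
  ring

lemma oddTheta_neg (z : ℂ) (r : ZMod 13) : oddTheta z (-r) = -oddTheta z r := by
  rw [oddTheta, oddTheta, ← tsum_neg, ← Equiv.tsum_eq (Equiv.subLeft (-1 : ℤ))]
  refine tsum_congr fun l => ?_
  have h : ((2 * (Equiv.subLeft (-1) l) + 1 : ℤ) : ZMod 13) = -r ↔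
      ((2 * l + 1 : ℤ) : ZMod 13) = r := by
    rw [Equiv.subLeft_apply, ← neg_inj (b := r)]
    push_cast
    ring_nf
  rw [if_congr h rfl rfl]
  split_ifs
  · exact thetaTerm_neg_one_sub z l
  · simp

lemma oddTheta_two_mul_add_one (z : ℂ) (j : ℤ) {c : ℚ} (hc : (c : ℂ) = (2 * j + 1) ^ 2 / 104) :
    oddTheta z ((2 * j + 1 : ℤ) : ZMod 13) = (-1) ^ j * th13 c (2 * j + 1) z := by
  have hinj : Function.Injective fun n : ℤ => 13 * n + j := fun a b h => by
    simpa using h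
  rw [oddTheta, ← hinj.tsum_eq, th13, ← mul_assoc, ← tsum_mul_left]
  · refine tsum_congr fun n => ?_
    have h13 : (13 : ZMod 13) = 0 := rfl
    rw [if_pos (by push_cast; rw [h13]; ring), thetaTerm, hc, neg_one_zpow_eq_exp,
      neg_one_zpow_eq_exp, neg_one_zpow_eq_exp]
    simp only [← Complex.exp_add]
    rw [Complex.exp_eq_exp_iff_exists_int]
    refine ⟨6 * n, ?_⟩
    push_cast
    ring
  · intro l hl
    rw [Function.mem_support] at hl
    have hl' := (ite_ne_right_iff.mp hl).1
    rw [ZMod.intCast_eq_intCast_iff_dvd_sub] at hl'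
    obtain ⟨k, hk⟩ := hl'
    refine ⟨(l - j) / 13, ?_⟩
    have : ((13 : ℕ) : ℤ) = 13 := rfl
    change 13 * ((l - j) / 13) + j = l
    omega

lemma oddTheta_add_one (z : ℂ) (r : ZMod 13) :
    oddTheta (z + 1) r =
      exp (2 * Real.pi * I * (1 / 104 - 5 / 13)) * (ψ (5 * r ^ 2) * oddTheta z r) := by
  rw [oddTheta, oddTheta, ← tsum_mul_left, ← tsum_mul_left]
  refine tsum_congr fun l => ?_
  split_ifs with h
  · have e : (5 * r ^ 2 : ZMod 13) = ((5 * (2 * l + 1) ^ 2 : ℤ) : ZMod 13) := by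
      rw [← h]; push_cast; ring
    obtain ⟨t, ht⟩ := Int.even_mul_succ_self l
    rw [e, ψ, ZMod.stdAddChar_coe, thetaTerm, thetaTerm, mul_left_comm _ ((-1) ^ l),
      mul_left_comm _ ((-1) ^ l)]
    simp only [← Complex.exp_add]
    congr 1
    rw [Complex.exp_eq_exp_iff_exists_int]
    refine ⟨-3 * t, ?_⟩
    have ht' : (l * (l + 1) : ℂ) = t + t := by exact_mod_cast ht
    push_cast
    linear_combination (2 * Real.pi * I) * (-3 / 2) * ht'
  · simp

lemma fourier13_oddTheta {z : ℂ} (hz : 0 < z.im) (r : ZMod 13) :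
    fourier13 (oddTheta z) r = I / (-I * (z / 13)) ^ (1 / 2 : ℂ) * oddTheta (-1 / z) r := by
  have h1 : fourier13 (oddTheta z) r =
      ∑' l : ℤ, ψ (3 * r * ((2 * l + 1 : ℤ) : ZMod 13)) * thetaTerm z l := by
    simp only [fourier13, oddTheta, ← tsum_mul_left]
    rw [← Summable.tsum_finsetSum fun s _ => (summable_oddTheta hz s).mul_left _]
    refine tsum_congr fun l => ?_
    simp
  have hz0 : z ≠ 0 := by rintro rfl; simp at hz
  obtain ⟨r, rfl⟩ := ZMod.intCast_surjective r
  have h2 : ∀ l : ℤ, ψ (3 * (r : ZMod 13) * ((2 * l + 1 : ℤ) : ZMod 13)) * thetaTerm z l =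
      exp (2 * Real.pi * I * (3 * r / 13) + Real.pi * I * z / 52) *
        jacobiTheta₂_term l (1 / 2 + 2 * (3 * r / 13) + z / 26) (z / 13) := fun l => by
    rw [← exp_mul_thetaTerm]
    have : (3 * (r : ZMod 13) * ((2 * l + 1 : ℤ) : ZMod 13)) =
        ((3 * r * (2 * l + 1) : ℤ) : ZMod 13) := by push_cast; ring
    rw [this, ψ, ZMod.stdAddChar_coe]
    congr 2
    push_cast
    ring
  have h3 : ((r : ℤ) : ZMod 13) = ((2 * (-6 * r - 7) + 1 : ℤ) : ZMod 13) := by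
    rw [ZMod.intCast_eq_intCast_iff_dvd_sub]
    exact ⟨-r - 1, by push_cast; ring⟩
  have h4 : (-1 : ℂ) ^ (-6 * r - 7) = -1 := by
    refine Odd.neg_one_zpow ⟨-3 * r - 4, by ring⟩
  rw [h1, tsum_congr h2, tsum_mul_left, ← jacobiTheta₂, jacobiTheta₂_functional_equation, h3,
    oddTheta_two_mul_add_one (c := (12 * r + 13) ^ 2 / 104) _ _ (by push_cast; ring), h4, th13,
    jacobiTheta₂]
  have h5 : ∀ n : ℤ, jacobiTheta₂_term n ((1 / 2 + 2 * (3 * r / 13) + z / 26) / (z / 13))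
      (-1 / (z / 13)) = (-1) ^ n * exp (2 * Real.pi * I *
        (((13 * n ^ 2 + (2 * (-6 * r - 7) + 1) * n : ℤ) : ℂ) / 2) * (-1 / z)) := fun n => by
    rw [jacobiTheta₂_term, neg_one_zpow_eq_exp, ← Complex.exp_add]
    congr 1
    push_cast
    field_simp
    ring
  rw [tsum_congr h5]
  have h6 : exp (2 * Real.pi * I * (3 * r / 13) + Real.pi * I * z / 52) *
      exp (-Real.pi * I * (1 / 2 + 2 * (3 * r / 13) + z / 26) ^ 2 / (z / 13)) =
      -I * exp (2 * Real.pi * I * (((12 * r + 13) ^ 2 / 104 : ℚ) : ℂ) * (-1 / z)) := by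
    have : -I = exp (-(Real.pi / 2) * I) := by
      rw [neg_mul, Complex.exp_neg, exp_pi_div_two_mul_I, inv_I]
    rw [this, ← Complex.exp_add, ← Complex.exp_add]
    congr 1
    push_cast
    field_simp
    ring
  linear_combination (1 / (-I * (z / 13)) ^ (1 / 2 : ℂ)) *
    (∑' n : ℤ, (-1) ^ n * exp (2 * Real.pi * I *
        (((13 * n ^ 2 + (2 * (-6 * r - 7) + 1) * n : ℤ) : ℂ) / 2) * (-1 / z))) * h6

lemma restr_oddTheta (z : ℂ) : restr (oddTheta z) = AV z := by
  have h2 : oddTheta z 2 = th13 (121 / 104) 11 z := by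
    rw [show (2 : ZMod 13) = -((2 * 5 + 1 : ℤ) : ZMod 13) from rfl, oddTheta_neg,
      oddTheta_two_mul_add_one z 5 (c := 121 / 104) (by norm_num)]
    norm_num
  have h6 : oddTheta z 6 = th13 (49 / 104) 7 z := by
    rw [show (6 : ZMod 13) = -((2 * 3 + 1 : ℤ) : ZMod 13) from rfl, oddTheta_neg,
      oddTheta_two_mul_add_one z 3 (c := 49 / 104) (by norm_num)]
    norm_num
  have h5 : oddTheta z 5 = th13 (25 / 104) 5 z := by
    rw [show (5 : ZMod 13) = ((2 * 2 + 1 : ℤ) : ZMod 13) from rfl,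
      oddTheta_two_mul_add_one z 2 (c := 25 / 104) (by norm_num)]
    norm_num
  have h3 : oddTheta z 3 = -th13 (9 / 104) 3 z := by
    rw [show (3 : ZMod 13) = ((2 * 1 + 1 : ℤ) : ZMod 13) from rfl,
      oddTheta_two_mul_add_one z 1 (c := 9 / 104) (by norm_num)]
    norm_num
  have h9 : oddTheta z 9 = th13 (81 / 104) 9 z := by
    rw [show (9 : ZMod 13) = ((2 * 4 + 1 : ℤ) : ZMod 13) from rfl,
      oddTheta_two_mul_add_one z 4 (c := 81 / 104) (by norm_num)]
    norm_num
  have h1 : oddTheta z 1 = th13 (1 / 104) 1 z := by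
    rw [show (1 : ZMod 13) = ((2 * 0 + 1 : ℤ) : ZMod 13) from rfl,
      oddTheta_two_mul_add_one z 0 (c := 1 / 104) (by norm_num)]
    norm_num
  ext i
  fin_cases i
  exacts [h2, h6, h5, h3, h9, h1]

lemma oddExt_AV (z : ℂ) : oddExt (AV z) = oddTheta z := by
  rw [← restr_oddTheta, oddExt_restr (oddTheta_neg z)]

lemma AV_add_one (z : ℂ) :
    AV (z + 1) = exp (2 * Real.pi * I * (1 / 104 - 5 / 13)) • weightScale ζ (AV z) := by
  have e : oddTheta (z + 1) =
      exp (2 * Real.pi * I * (1 / 104 - 5 / 13)) • chirp 1 (oddTheta z) := by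
    ext r
    rw [oddTheta_add_one, Pi.smul_apply, chirp, mul_one, smul_eq_mul]
  have h := weightScale_eq_restr_chirp 1 (AV z)
  rw [pow_one, Nat.cast_one, oddExt_AV] at h
  rw [h, ← restr_oddTheta, e, restr_smul]

lemma Phi30_AV_neg_inv {z : ℂ} (hz : 0 < z.im) :
    Phi30 (AV (-1 / z)) = (I * z) ^ 15 * Phi30 (AV z) := by
  have hz0 : z ≠ 0 := by rintro rfl; simp at hz
  have h := Phi30_fourier (AV z)
  have e : fourier13 (oddTheta z) =
      (I / (-I * (z / 13)) ^ (1 / 2 : ℂ)) • oddTheta (-1 / z) :=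
    funext fun r => fourier13_oddTheta hz r
  have h2 : ((-I * (z / 13)) ^ (1 / 2 : ℂ)) ^ 2 = -I * (z / 13) := by
    rw [← Complex.cpow_nat_mul]
    norm_num
  have h3 : (I / (-I * (z / 13)) ^ (1 / 2 : ℂ)) ^ 2 = 13 / (I * z) := by
    rw [div_pow, h2, I_sq]
    have := I_ne_zero
    field_simp
  rw [oddExt_AV, e, restr_smul, Phi30_smul, restr_oddTheta, show 30 = 2 * 15 from rfl, pow_mul,
    h3, div_pow, div_mul_eq_mul_div, div_eq_iff (pow_ne_zero _ (mul_ne_zero I_ne_zero hz0))] at h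
  linear_combination h / 13 ^ 15

lemma xV_eq_smul (z : ℂ) : xV z = etaF z • AV z := rfl

lemma etaF_eq_eta : etaF = ModularForm.eta := by
  ext z
  rw [etaF, ModularForm.eta, Function.Periodic.qParam]
  simp only [ModularForm.eta_q_eq_pow]
  norm_num

lemma etaF_add_one (z : ℂ) : etaF (z + 1) = exp (2 * Real.pi * I * (1 / 24)) * etaF z := by
  have h : exp (2 * Real.pi * I * (z + 1)) = exp (2 * Real.pi * I * z) := by
    rw [mul_add, mul_one, Complex.exp_add, Complex.exp_two_pi_mul_I, mul_one]
  rw [etaF, etaF, h, ← mul_assoc, ← Complex.exp_add]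
  congr 2
  ring

lemma etaF_neg_inv_sq {z : ℂ} (hz : 0 < z.im) : etaF (-1 / z) ^ 2 = -I * z * etaF z ^ 2 := by
  have h := ModularForm.eta_comp_eq_csqrt_I_inv (show z ∈ UpperHalfPlane.upperHalfPlaneSet from hz)
  have hs : ∀ w : ℂ, sqrt w ^ 2 = w := fun w => by
    rw [sqrt, ← Complex.cpow_nat_mul]
    norm_num
  simp only [Function.comp_apply, Pi.smul_apply, Pi.mul_apply, smul_eq_mul] at h
  rw [etaF_eq_eta, h, mul_pow, mul_pow, inv_pow, hs, hs, inv_I, mul_assoc]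

lemma Phi30_xV (z : ℂ) : Phi30 (xV z) = etaF z ^ 30 * Phi30 (AV z) := by
  rw [xV_eq_smul, Phi30_smul]

lemma Phi30_xV_neg_inv {z : ℂ} (hz : 0 < z.im) :
    Phi30 (xV (-1 / z)) = z ^ 30 * Phi30 (xV z) := by
  rw [Phi30_xV, Phi30_xV, Phi30_AV_neg_inv hz, show 30 = 2 * 15 from rfl, pow_mul,
    etaF_neg_inv_sq hz, mul_pow, mul_pow, mul_pow, pow_mul z, pow_mul (etaF z)]
  have : (-I) ^ 15 * I ^ 15 = 1 := by rw [← mul_pow, neg_mul, I_mul_I, neg_neg, one_pow]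
  linear_combination z ^ 30 * (etaF z ^ 2) ^ 15 * Phi30 (AV z) * this

lemma Phi30_xV_add_one (z : ℂ) : Phi30 (xV (z + 1)) = Phi30 (xV z) := by
  have h : exp (2 * Real.pi * I * (1 / 24)) ^ 30 *
      exp (2 * Real.pi * I * (1 / 104 - 5 / 13)) ^ 30 = 1 := by
    rw [← Complex.exp_nat_mul, ← Complex.exp_nat_mul, ← Complex.exp_add,
      Complex.exp_eq_one_iff]
    exact ⟨-10, by push_cast; ring⟩
  rw [Phi30_xV, Phi30_xV, etaF_add_one, AV_add_one, Phi30_smul, Phi30_weightScale]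
  linear_combination etaF z ^ 30 * Phi30 (AV z) * h

lemma Δfun_neg_inv {z : ℂ} (hz : 0 < z.im) : Δfun (-1 / z) = z ^ 12 * Δfun z := by
  have : (-I) ^ 12 = 1 := by
    rw [Even.neg_pow (by decide), show 12 = 4 * 3 from rfl,
      pow_mul, I_pow_four, one_pow]
  rw [Δfun, Δfun, show 24 = 2 * 12 from rfl, pow_mul, etaF_neg_inv_sq hz, mul_pow, mul_pow, this]
  ring

lemma Δfun_add_one (z : ℂ) : Δfun (z + 1) = Δfun z := by
  rw [Δfun, Δfun, etaF_add_one, mul_pow, ← Complex.exp_nat_mul]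
  have : exp ((24 : ℕ) * (2 * Real.pi * I * (1 / 24))) = 1 := by
    rw [Complex.exp_eq_one_iff]
    exact ⟨1, by push_cast; ring⟩
  rw [this, one_mul]

lemma norm_theta_series_sub_one_le {k : ℤ} (hk : |k| ≤ 11) {z : ℂ} (hz : 0 < z.im)
    (hq : ‖exp (2 * Real.pi * I * z)‖ ≤ 1 / 2) :
    ‖∑' n : ℤ, (-1 : ℂ) ^ n *
      exp (2 * Real.pi * I * (((13 * n ^ 2 + k * n : ℤ) : ℂ) / 2) * z) - 1‖ ≤
      4 * ‖exp (2 * Real.pi * I * z)‖ := by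
  set r := ‖exp (2 * Real.pi * I * z)‖ with hr
  have hr0 : 0 ≤ r := norm_nonneg _
  set f : ℤ → ℂ := fun n => (-1 : ℂ) ^ n *
    exp (2 * Real.pi * I * (((13 * n ^ 2 + k * n : ℤ) : ℂ) / 2) * z) with hf
  have hbound : ∀ (n : ℤ) (m : ℕ), 2 * (m : ℤ) ≤ 13 * n ^ 2 + k * n → ‖f n‖ ≤ r ^ m := by
    intro n m h
    rw [hf, hr, norm_mul, norm_zpow, norm_neg, norm_one, one_zpow, one_mul, ← norm_pow,
      ← Complex.exp_nat_mul, Complex.norm_exp, Complex.norm_exp, Real.exp_le_exp]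
    have e1 : (2 * Real.pi * I * (((13 * n ^ 2 + k * n : ℤ) : ℂ) / 2) * z).re =
        -(Real.pi * z.im) * ((13 * n ^ 2 + k * n : ℤ) : ℝ) := by
      rw [show 2 * Real.pi * I * (((13 * n ^ 2 + k * n : ℤ) : ℂ) / 2) * z =
        ((Real.pi * ((13 * n ^ 2 + k * n : ℤ) : ℝ) : ℝ) : ℂ) * (I * z) by push_cast; ring,
        Complex.re_ofReal_mul]
      simp
      ring
    have e2 : ((m : ℂ) * (2 * Real.pi * I * z)).re =
        -(Real.pi * z.im) * ((2 * (m : ℤ) : ℤ) : ℝ) := by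
      rw [show (m : ℂ) * (2 * Real.pi * I * z) =
        ((Real.pi * (2 * m) : ℝ) : ℂ) * (I * z) by push_cast; ring, Complex.re_ofReal_mul]
      simp
      ring
    rw [e1, e2, neg_mul, neg_mul, neg_le_neg_iff]
    exact mul_le_mul_of_nonneg_left (by exact_mod_cast h) (by positivity)
  have hk' := abs_le.mp hk
  have hpos : ∀ m : ℕ, ‖f (m + 1)‖ ≤ r ^ (m + 1) := fun m => hbound _ _ (by push_cast; nlinarith)
  have hneg : ∀ m : ℕ, ‖f (-(m + 1))‖ ≤ r ^ (m + 1) := fun m =>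
    hbound _ _ (by push_cast; nlinarith)
  have hgeom : HasSum (fun m : ℕ => r ^ (m + 1)) (r * (1 - r)⁻¹) := by
    simpa only [pow_succ'] using (hasSum_geometric_of_lt_one hr0 (by linarith)).mul_left r
  have hs1 := Summable.of_norm_bounded hgeom.summable hpos
  have hs2 := Summable.of_norm_bounded hgeom.summable hneg
  have h0 : f 0 = 1 := by simp [hf]
  have hle : r * (1 - r)⁻¹ ≤ 2 * r := by
    rw [← div_eq_mul_inv, div_le_iff₀ (by linarith)]
    nlinarith
  rw [tsum_of_add_one_of_neg_add_one hs1 hs2, h0, add_right_comm, add_sub_cancel_right]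
  calc _ ≤ r * (1 - r)⁻¹ + r * (1 - r)⁻¹ := (norm_add_le _ _).trans
        (add_le_add (tsum_of_norm_bounded hgeom hpos) (tsum_of_norm_bounded hgeom hneg))
    _ ≤ 4 * r := by linarith

/-- The local parameter at the cusp for the principal congruence subgroup of level 13. -/
def cuspParam (z : UpperHalfPlane) : ℂ := exp (2 * Real.pi * I * z / 13)

open Filter Topology Asymptotics
open UpperHalfPlane hiding I

lemma tendsto_cuspParam : Tendsto cuspParam atImInfty (𝓝 0) := by
  have := qParam_tendsto_atImInfty (h := 13) (by norm_num)
  refine this.congr fun z => ?_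
  simp [cuspParam, Function.Periodic.qParam]

lemma cuspParam_ne_zero (z : UpperHalfPlane) : cuspParam z ≠ 0 := exp_ne_zero _

lemma isBigO_th13 {k : ℤ} (hk : |k| ≤ 11) {c : ℚ} {m : ℕ} (hc : c = (8 * m + 1) / 104) :
    (fun z : UpperHalfPlane => exp (-(2 * Real.pi * I * z / 104)) * th13 c k z - cuspParam z ^ m)
      =O[atImInfty] fun z => cuspParam z ^ (m + 13) := by
  have h13 : ∀ z : UpperHalfPlane, cuspParam z ^ 13 = exp (2 * Real.pi * I * z) := fun z => by
    rw [cuspParam, ← Complex.exp_nat_mul]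
    congr 1
    push_cast
    ring
  refine IsBigO.of_bound 4 ?_
  have hsmall : ∀ᶠ z in atImInfty, ‖cuspParam z ^ 13‖ ≤ 1 / 2 := by
    have := (tendsto_cuspParam.pow 13).norm
    rw [zero_pow (by norm_num), norm_zero] at this
    exact this.eventually_le_const (by norm_num)
  filter_upwards [hsmall] with z hz
  rw [h13] at hz
  have h := norm_theta_series_sub_one_le hk z.im_pos hz
  have e : exp (-(2 * Real.pi * I * z / 104)) * exp (2 * Real.pi * I * (c : ℂ) * z) =
      cuspParam z ^ m := by
    rw [cuspParam, ← Complex.exp_nat_mul, ← Complex.exp_add, hc]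
    congr 1
    push_cast
    ring
  rw [th13, ← mul_assoc, e, ← mul_sub_one, pow_add, norm_mul, norm_mul, h13]
  calc _ ≤ ‖cuspParam z ^ m‖ * (4 * ‖exp (2 * Real.pi * I * z)‖) := by gcongr
    _ = _ := by ring

/-- The leading terms of the normalized theta constants at the cusp. -/
def cuspCurve (w : ℂ) : Fin 6 → ℂ := ![0, w ^ 6, w ^ 3, -w, 0, 1]

lemma weightScale_cuspCurve (y w : ℂ) :
    weightScale y (cuspCurve w) = y ^ 5 • cuspCurve (y * w) := by
  ext i
  fin_cases i <;> simp [weightScale, cuspCurve] <;> ring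

lemma GG0_cuspCurve (w : ℂ) : GG0 (cuspCurve w) = 0 := by
  simp [GG0, DD0, DDinf, cuspCurve]

/-- The terms of order at least seven in `dF 0` along the cuspidal curve. -/
def dFTail (w : ℂ) : ℂ :=
  -8 + 17 * w + 9 * w ^ 3 - 28 * w ^ 4 + 7 * w ^ 5 - 6 * w ^ 6 - 6 * w ^ 7 + 34 * w ^ 8
    - 20 * w ^ 9 - 8 * w ^ 10 - 36 * w ^ 11 + 36 * w ^ 12 - 8 * w ^ 13 + 28 * w ^ 14
    + 4 * w ^ 16 - 20 * w ^ 17 + 6 * w ^ 18 + w ^ 19 - 8 * w ^ 20 + 4 * w ^ 21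
    + 4 * w ^ 23 - 2 * w ^ 26 - w ^ 29

lemma dF_zero_cuspCurve (w : ℂ) : dF 0 (cuspCurve w) =
    (-1 + 2 * w + 2 * w ^ 2 - 2 * w ^ 3 - 8 * w ^ 4 + 6 * w ^ 5 + w ^ 6) + w ^ 7 * dFTail w := by
  have h0 : DD0 (cuspCurve w) = 0 := by simp [DD0, cuspCurve]
  have hi : DDinf (cuspCurve w) = 0 := by simp [DDinf, cuspCurve]
  have h1 : DD1 (cuspCurve w) = 3 * w ^ 12 := by simp [DD1, cuspCurve]; ring
  have h2 : DD2 (cuspCurve w) = -1 - w ^ 13 := by simp [DD2, cuspCurve]; ring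
  have h3 : DD3 (cuspCurve w) = w := by simp [DD3, cuspCurve]
  have h4 : DD4 (cuspCurve w) = -2 * w ^ 2 - w ^ 15 := by simp [DD4, cuspCurve]; ring
  have h5 : DD5 (cuspCurve w) = -w ^ 3 := by simp [DD5, cuspCurve]; ring
  have h6 : DD6 (cuspCurve w) = -w ^ 4 := by simp [DD6, cuspCurve]; ring
  have h7 : DD7 (cuspCurve w) = w ^ 5 - w ^ 18 := by simp [DD7, cuspCurve]; ring
  have h8 : DD8 (cuspCurve w) = 3 * w ^ 6 := by simp [DD8, cuspCurve]; ring
  have h9 : DD9 (cuspCurve w) = -2 * w ^ 7 := by simp [DD9, cuspCurve]; ring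
  have h10 : DD10 (cuspCurve w) = w ^ 8 := by simp [DD10, cuspCurve]; ring
  have h11 : DD11 (cuspCurve w) = -4 * w ^ 9 := by simp [DD11, cuspCurve]; ring
  have h12 : DD12 (cuspCurve w) = w ^ 10 := by simp [DD12, cuspCurve]; ring
  simp only [dF, GG0, GG1, GG2, GG3, GG4, GG5, GG6, GG7, GG8, GG9, GG10, GG11, GG12, h0, hi, h1,
    h2, h3, h4, h5, h6, h7, h8, h9, h10, h11, h12, mul_zero, pow_zero, one_mul, dFTail]
  ring

lemma exists_dF_zero_cuspCurve_pow_five : ∃ R : ℂ → ℂ, Continuous R ∧ ∀ w,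
    dF 0 (cuspCurve w) ^ 5 = -1 + 10 * w - 30 * w ^ 2 - 10 * w ^ 3 + 160 * w ^ 4 + 142 * w ^ 5
      - 1315 * w ^ 6 + w ^ 7 * R w := by
  set p : ℂ → ℂ := fun w => -1 + 2 * w + 2 * w ^ 2 - 2 * w ^ 3 - 8 * w ^ 4 + 6 * w ^ 5 + w ^ 6
    with hp
  set s : ℂ → ℂ := fun w => 280 + 4640 * w - 40 * w ^ 2 - 18288 * w ^ 3 + 5240 * w ^ 4
    + 42430 * w ^ 5 - 4740 * w ^ 6 - 101820 * w ^ 7 + 27828 * w ^ 8 + 147760 * w ^ 9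
    - 20540 * w ^ 10 - 223870 * w ^ 11 + 79480 * w ^ 12 + 170672 * w ^ 13 - 47400 * w ^ 14
    - 154720 * w ^ 15 + 99800 * w ^ 16 + 11395 * w ^ 17 - 16854 * w ^ 18 - 1750 * w ^ 19
    + 1190 * w ^ 20 + 320 * w ^ 21 + 30 * w ^ 22 + w ^ 23 with hs
  have h : ∀ w, p w ^ 5 = -1 + 10 * w - 30 * w ^ 2 - 10 * w ^ 3 + 160 * w ^ 4 + 142 * w ^ 5
      - 1315 * w ^ 6 + w ^ 7 * s w := fun w => by
    simp only [hp, hs]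
    ring
  refine ⟨fun w => s w + dFTail w * (5 * p w ^ 4 + 10 * p w ^ 3 * (w ^ 7 * dFTail w)
    + 10 * p w ^ 2 * (w ^ 7 * dFTail w) ^ 2 + 5 * p w * (w ^ 7 * dFTail w) ^ 3
    + (w ^ 7 * dFTail w) ^ 4), ?_, fun w => ?_⟩
  · simp only [hp, hs, dFTail]
    fun_prop
  · rw [dF_zero_cuspCurve]
    linear_combination h w

lemma sum_ζ_pow_mul (k : ℕ) :
    ∑ ν ∈ Finset.range 13, ζ ^ (k * ν) = if 13 ∣ k then 13 else 0 := by
  split_ifs with h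
  · obtain ⟨m, rfl⟩ := h
    simp [mul_assoc, pow_mul, ζ_pow_thirteen]
  · have hz : IsPrimitiveRoot ζ 13 := Complex.isPrimitiveRoot_exp 13 (by norm_num)
    have h1 : ζ ^ k ≠ 1 := fun e => h (hz.pow_eq_one_iff_dvd k |>.mp e)
    simp_rw [pow_mul]
    have := mul_neg_geom_sum (ζ ^ k) 13
    rw [← pow_mul, mul_comm k 13, pow_mul, ζ_pow_thirteen, one_pow, sub_self, mul_eq_zero] at this
    exact this.resolve_left (sub_ne_zero.mpr h1.symm)

lemma exists_Phi30_cuspCurve : ∃ S : ℂ → ℂ, Continuous S ∧ ∀ w,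
    Phi30 (cuspCurve w) = w ^ 6 + w ^ 7 * S w := by
  obtain ⟨R, hR, h⟩ := exists_dF_zero_cuspCurve_pow_five
  refine ⟨fun w => -(1 / (13 * 1315) : ℂ) * ∑ ν ∈ Finset.range 13, ζ ^ (157 * ν) * R (ζ ^ ν * w),
    by fun_prop, fun w => ?_⟩
  have hd : ∀ ν, dF ν (cuspCurve w) ^ 5 = ζ ^ (150 * ν) * (-1) + ζ ^ (151 * ν) * (10 * w)
      + ζ ^ (152 * ν) * (-30 * w ^ 2) + ζ ^ (153 * ν) * (-10 * w ^ 3)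
      + ζ ^ (154 * ν) * (160 * w ^ 4) + ζ ^ (155 * ν) * (142 * w ^ 5)
      + ζ ^ (156 * ν) * (-1315 * w ^ 6) + w ^ 7 * (ζ ^ (157 * ν) * R (ζ ^ ν * w)) := fun ν => by
    rw [dF_eq_dF_zero_weightScale, weightScale_cuspCurve, dF_smul, mul_pow, h]
    ring
  simp only [Phi30, hd, Finset.sum_add_distrib, ← Finset.sum_mul, ← Finset.mul_sum, sum_ζ_pow_mul,
    dInf, GG0_cuspCurve]
  norm_num
  ring

lemma contDiff_Phi30 : ContDiff ℂ 1 Phi30 := by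
  unfold Phi30 dF dInf GG0 GG1 GG2 GG3 GG4 GG5 GG6 GG7 GG8 GG9 GG10 GG11 GG12 DD0 DD1 DD2 DD3 DD4
    DD5 DD6 DD7 DD8 DD9 DD10 DD11 DD12 DDinf
  fun_prop

lemma isBigO_cuspParam_pow {m n : ℕ} (h : m ≤ n) :
    (fun z => cuspParam z ^ n) =O[atImInfty] fun z => cuspParam z ^ m := by
  obtain ⟨d, rfl⟩ := Nat.exists_eq_add_of_le h
  simp_rw [pow_add]
  simpa using (isBigO_refl (fun z => cuspParam z ^ m) atImInfty).mul
    ((tendsto_cuspParam.pow d).isBigO_one ℂ)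

lemma isBigO_AV :
    (fun z : ℍ => exp (-(2 * Real.pi * I * z / 104)) • AV z - cuspCurve (cuspParam z))
      =O[atImInfty] fun z => cuspParam z ^ 7 := by
  have key : ∀ {k : ℤ} {c : ℚ} (m : ℕ), |k| ≤ 11 → c = (8 * m + 1) / 104 →
      (fun z : ℍ => exp (-(2 * Real.pi * I * z / 104)) * th13 c k z - cuspParam z ^ m)
      =O[atImInfty] fun z => cuspParam z ^ 7 := fun m hk hc =>
    (isBigO_th13 hk hc).trans (isBigO_cuspParam_pow (by lia))
  rw [isBigO_pi]
  intro i
  fin_cases i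
  · simpa [AV, ta, cuspCurve] using (key (k := 11) (c := 121 / 104) 15 (by norm_num)
      (by norm_num)).add (isBigO_cuspParam_pow (show 7 ≤ 15 by norm_num))
  · simpa [AV, ta, cuspCurve] using key (k := 7) (c := 49 / 104) 6 (by norm_num) (by norm_num)
  · simpa [AV, ta, cuspCurve] using key (k := 5) (c := 25 / 104) 3 (by norm_num) (by norm_num)
  · simpa [AV, ta, cuspCurve, add_comm, sub_eq_add_neg] using
      (key (k := 3) (c := 9 / 104) 1 (by norm_num) (by norm_num)).neg_left
  · simpa [AV, ta, cuspCurve] using (key (k := 9) (c := 81 / 104) 10 (by norm_num)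
      (by norm_num)).add (isBigO_cuspParam_pow (show 7 ≤ 10 by norm_num))
  · simpa [AV, ta, cuspCurve] using key (k := 1) (c := 1 / 104) 0 (by norm_num) (by norm_num)

lemma isBigO_Phi30_AV :
    (fun z : ℍ => Phi30 (exp (-(2 * Real.pi * I * z / 104)) • AV z) - cuspParam z ^ 6)
      =O[atImInfty] fun z => cuspParam z ^ 7 := by
  obtain ⟨S, hS, h⟩ := exists_Phi30_cuspCurve
  have hc : Tendsto (fun z => cuspCurve (cuspParam z)) atImInfty (𝓝 (cuspCurve 0)) := by
    have : Continuous cuspCurve := by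
      refine continuous_pi fun i => ?_
      fin_cases i <;> simp [cuspCurve] <;> fun_prop
    exact this.continuousAt.tendsto.comp tendsto_cuspParam
  have h0 : Tendsto (fun z : ℍ => exp (-(2 * Real.pi * I * z / 104)) • AV z) atImInfty
      (𝓝 (cuspCurve 0)) := by
    have := (isBigO_AV.trans_tendsto
      (by simpa using tendsto_cuspParam.pow 7)).add hc
    simpa using this
  have hd := (contDiff_Phi30.contDiffAt.hasStrictFDerivAt (x := cuspCurve 0) one_ne_zero).isBigO_sub
  have h1 := (hd.comp_tendsto (h0.prodMk_nhds hc)).trans isBigO_AV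
  have h2 : (fun z => cuspParam z ^ 7 * S (cuspParam z)) =O[atImInfty]
      fun z => cuspParam z ^ 7 := by
    simpa using (isBigO_refl (fun z => cuspParam z ^ 7) atImInfty).mul
      ((hS.continuousAt.tendsto.comp tendsto_cuspParam).isBigO_one ℂ)
  refine (h1.add h2).congr_left fun z => ?_
  simp only [Function.comp_apply, h]
  ring

lemma tendsto_Phi30_AV :
    Tendsto (fun z : ℍ => (cuspParam z ^ 6)⁻¹ *
      Phi30 (exp (-(2 * Real.pi * I * z / 104)) • AV z)) atImInfty (𝓝 1) := by
  have h := ((isBigO_refl (fun z => (cuspParam z ^ 6)⁻¹) atImInfty).mul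
    isBigO_Phi30_AV).trans_tendsto (tendsto_cuspParam.congr fun z => by
      rw [pow_succ (cuspParam z) 6, inv_mul_cancel_left₀ (pow_ne_zero 6 (cuspParam_ne_zero z))])
  rw [← zero_add (1 : ℂ)]
  refine (h.add_const 1).congr fun z => ?_
  rw [mul_sub, inv_mul_cancel₀ (pow_ne_zero 6 (cuspParam_ne_zero z)), sub_add_cancel]

lemma tendsto_eta_tprod : Tendsto (fun z : ℍ =>
    ∏' n : ℕ, (1 - exp (2 * Real.pi * I * z) ^ (n + 1))) atImInfty (𝓝 1) := by
  have htprod : Tendsto (fun q : ℂ => ∏' n : ℕ, (1 - q ^ (n + 1))) (𝓝 0) (𝓝 1) := by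
    have := tendsto_tprod_one_add_of_dominated_convergence (𝓕 := 𝓝 0) (g := 0)
      (f := fun (q : ℂ) (n : ℕ) => -q ^ (n + 1)) (bound := fun n => (1 / 2 : ℝ) ^ (n + 1))
    simp only [Pi.zero_apply, norm_neg, norm_pow, add_zero, tprod_one] at this
    simp_rw [sub_eq_add_neg]
    refine this
      (by simpa only [pow_succ'] using (summable_geometric_of_abs_lt_one (by norm_num)).mul_left _)
      (fun k => by simpa using ((continuous_pow (M := ℂ) (k + 1)).tendsto 0).neg) ?_
    filter_upwards [Metric.ball_mem_nhds (0 : ℂ) (by norm_num : (0 : ℝ) < 1 / 2)] with q hq k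
    exact pow_le_pow_left₀ (norm_nonneg _) (mem_ball_zero_iff.mp hq).le _
  have := htprod.comp (qParam_tendsto_atImInfty zero_lt_one)
  refine this.congr fun z => ?_
  simp [Function.Periodic.qParam]

/-- The quotient of `Phi30` at the theta constants by the squared discriminant. -/
def phiQuotient (z : ℂ) : ℂ := Phi30 (xV z) / Δfun z ^ 2

lemma etaF_ne_zero {z : ℂ} (hz : 0 < z.im) : etaF z ≠ 0 := by
  rw [etaF_eq_eta]
  exact ModularForm.eta_ne_zero hz

lemma Δfun_ne_zero {z : ℂ} (hz : 0 < z.im) : Δfun z ≠ 0 := pow_ne_zero _ (etaF_ne_zero hz)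

lemma tendsto_phiQuotient : Tendsto (fun z : ℍ => phiQuotient z) atImInfty (𝓝 1) := by
  have h := tendsto_Phi30_AV.mul ((tendsto_eta_tprod.inv₀ one_ne_zero).pow 18)
  rw [inv_one, one_pow, mul_one] at h
  refine h.congr fun z => ?_
  set T := ∏' n : ℕ, (1 - exp (2 * Real.pi * I * z) ^ (n + 1)) with hT
  have hη : etaF z = exp (2 * Real.pi * I * z / 24) * T := rfl
  have hT0 : T ≠ 0 := fun h => etaF_ne_zero z.im_pos (by rw [hη, h, mul_zero])
  have he : exp (-(2 * Real.pi * I * z / 104)) ^ 30 * exp (2 * Real.pi * I * z / 24) ^ 18 =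
      cuspParam z ^ 6 := by
    rw [cuspParam, ← Complex.exp_nat_mul, ← Complex.exp_nat_mul, ← Complex.exp_nat_mul,
      ← Complex.exp_add]
    congr 1
    push_cast
    ring
  rw [phiQuotient, Phi30_xV, Phi30_smul, Δfun, hη, ← he]
  have h1 := exp_ne_zero (-(2 * Real.pi * I * z / 104))
  have h2 := exp_ne_zero (2 * Real.pi * I * z / 24)
  field_simp

lemma th13_eq_jacobiTheta₂ (c : ℚ) (k : ℤ) (z : ℂ) : th13 c k z =
    exp (2 * Real.pi * I * c * z) * jacobiTheta₂ (1 / 2 + k * z / 2) (13 * z) := by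
  rw [th13, jacobiTheta₂]
  congr 1
  refine tsum_congr fun n => ?_
  rw [jacobiTheta₂_term, neg_one_zpow_eq_exp, ← Complex.exp_add]
  congr 1
  push_cast
  ring

lemma differentiableAt_th13 (c : ℚ) (k : ℤ) {z : ℂ} (hz : 0 < z.im) :
    DifferentiableAt ℂ (th13 c k) z := by
  have h13 : 0 < (13 * z).im := by simpa using hz
  have h := (hasFDerivAt_jacobiTheta₂ (1 / 2 + k * z / 2) h13).differentiableAt
  have hf : DifferentiableAt ℂ (fun z : ℂ => ((1 / 2 + k * z / 2 : ℂ), 13 * z)) z := by fun_prop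
  have := DifferentiableAt.comp (f := fun z : ℂ => ((1 / 2 + k * z / 2 : ℂ), 13 * z)) z h hf
  simp only [funext (th13_eq_jacobiTheta₂ c k)]
  exact DifferentiableAt.mul (by fun_prop) this

lemma differentiableAt_phiQuotient {z : ℂ} (hz : 0 < z.im) :
    DifferentiableAt ℂ phiQuotient z := by
  have hη : DifferentiableAt ℂ etaF z := by
    rw [etaF_eq_eta]
    exact ModularForm.differentiableAt_eta_of_mem_upperHalfPlaneSet hz
  have hx : DifferentiableAt ℂ xV z := by
    refine differentiableAt_pi.mpr fun i => hη.mul ?_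
    fin_cases i
    · exact differentiableAt_th13 _ _ hz
    · exact differentiableAt_th13 _ _ hz
    · exact differentiableAt_th13 _ _ hz
    · exact (differentiableAt_th13 _ _ hz).neg
    · exact differentiableAt_th13 _ _ hz
    · exact differentiableAt_th13 _ _ hz
  have hΦ : DifferentiableAt ℂ (fun z => Phi30 (xV z)) z :=
    ((contDiff_Phi30.differentiable one_ne_zero) (xV z)).comp z hx
  exact hΦ.div ((hη.pow 24).pow 2) (pow_ne_zero 2 (Δfun_ne_zero hz))

lemma phiQuotient_neg_inv {z : ℂ} (hz : 0 < z.im) :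
    phiQuotient (-1 / z) = z ^ 6 * phiQuotient z := by
  have hz0 : z ≠ 0 := by rintro rfl; simp at hz
  rw [phiQuotient, phiQuotient, Phi30_xV_neg_inv hz, Δfun_neg_inv hz]
  have := Δfun_ne_zero hz
  field_simp

lemma phiQuotient_add_one (z : ℂ) : phiQuotient (z + 1) = phiQuotient z := by
  rw [phiQuotient, phiQuotient, Phi30_xV_add_one, Δfun_add_one]

open ModularForm ModularGroup MatrixGroups

lemma phiQuotient_slash_S :
    (fun z : ℍ => phiQuotient z) ∣[(6 : ℤ)] S = fun z : ℍ => phiQuotient z := by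
  ext z
  have h : ((S • z : ℍ) : ℂ) = -1 / z := by
    rw [modular_S_smul, coe_mk, neg_div, one_div, inv_neg]
  rw [SL_slash_apply, h, phiQuotient_neg_inv z.im_pos, denom_S, zpow_neg, mul_comm,
    ← zpow_natCast]
  exact inv_mul_cancel_left₀ (zpow_ne_zero 6 z.ne_zero) _

lemma phiQuotient_slash_T :
    (fun z : ℍ => phiQuotient z) ∣[(6 : ℤ)] T = fun z : ℍ => phiQuotient z := by
  ext z
  have h : ((T • z : ℍ) : ℂ) = z + 1 := by
    rw [modular_T_smul, coe_vadd, add_comm, ofReal_one]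
  have h0 : (T 1 0 : ℤ) = 0 := rfl
  have h1 : (T 1 1 : ℤ) = 1 := rfl
  have hd : denom T z = 1 := by
    rw [ModularGroup.denom_apply, h0, h1]
    simp
  rw [SL_slash_apply, h, phiQuotient_add_one, hd, one_zpow, mul_one]

/-- `phiQuotient` as a modular form of weight six and level one. -/
def phiQuotientMF : ModularForm 𝒮ℒ 6 where
  toFun z := phiQuotient z
  slash_action_eq' A hA := by
    obtain ⟨A, rfl⟩ := hA
    exact SlashInvariantForm.slash_action_generators_SL2Z phiQuotient_slash_S phiQuotient_slash_T A
  holo' := by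
    rw [UpperHalfPlane.mdifferentiable_iff]
    refine .congr (fun z hz => (differentiableAt_phiQuotient hz).differentiableWithinAt)
      fun z hz => ?_
    simp [ofComplex_apply_of_im_pos hz]
  bdd_at_cusps' hc := by
    rw [Subgroup.IsArithmetic.isCusp_iff_isCusp_SL2Z] at hc
    rw [OnePoint.isBoundedAt_iff_forall_SL2Z hc]
    intro γ _
    rw [SlashInvariantForm.slash_action_generators_SL2Z phiQuotient_slash_S phiQuotient_slash_T]
    exact tendsto_phiQuotient.isBigO_one ℝ

lemma phiQuotientMF_eq_E₆ : phiQuotientMF = E₆ := by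
  obtain ⟨c, hc⟩ : ∃ c : ℂ, c • E₆ = phiQuotientMF :=
    (finrank_eq_one_iff_of_nonzero' E₆ (EisensteinSeries.E_ne_zero _ ⟨3, rfl⟩)).mp
      (Module.rank_eq_one_iff_finrank_eq_one.mp levelOne_weight_six_rank_one) _
  have h1 : (qExpansion 1 phiQuotientMF).coeff 0 = 1 := by
    rw [qExpansion_coeff_zero one_pos
      (ModularFormClass.analyticAt_cuspFunction_zero _ one_pos one_mem_strictPeriods_SL)
      (SlashInvariantFormClass.periodic_comp_ofComplex _ one_mem_strictPeriods_SL)]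
    exact tendsto_phiQuotient.limUnder_eq
  have h2 : c • qExpansion 1 E₆ = qExpansion 1 phiQuotientMF := by
    rw [← ModularForm.qExpansion_smul one_pos one_mem_strictPeriods_SL c E₆,
      show (c • E₆ : ℍ → ℂ) = phiQuotientMF from congrArg DFunLike.coe hc]
  rw [← h2, PowerSeries.coeff_smul, EisensteinSeries.E_qExpansion_coeff_zero _ ⟨3, rfl⟩,
    smul_eq_mul, mul_one] at h1
  rw [← hc, h1, one_smul]

lemma E_apply_eq_Eis {k : ℕ} (hk : 3 ≤ k) (z : ℍ) : ModularForm.E hk z = Eis k z := by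
  change (1 / 2 : ℂ) * eisensteinSeries (N := 1) 0 k z = _
  rw [eisensteinSeries, Eis]
  congr 1
  let e : {p : ℤ × ℤ // Int.gcd p.1 p.2 = 1} ≃ EisensteinSeries.gammaSet 1 1 0 :=
    (finTwoArrowEquiv ℤ).symm.subtypeEquiv fun p => by
      rw [EisensteinSeries.gammaSet_one_mem_iff]
      simp
  rw [← e.tsum_eq]
  refine tsum_congr fun p => ?_
  simp [e, EisensteinSeries.eisSummand]

theorem stmt13 (z : ℂ) (hz : 0 < z.im) : Phi30 (xV z) = (Δfun z) ^ 2 * Eis 6 z := by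
  have h : phiQuotient z = Eis 6 z :=
    (DFunLike.congr_fun phiQuotientMF_eq_E₆ (⟨z, hz⟩ : ℍ)).trans (E_apply_eq_Eis _ _)
  rw [← h, phiQuotient, mul_div_cancel₀ _ (pow_ne_zero 2 (Δfun_ne_zero hz))]
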